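/- arXiv:2411.10763 — 10 statements merged into one kernel-verified Lean document; each statement's English description precedes it below -/
import Mathlib

section
/- For every integer k with 0 ≤ k ≤ p, the following are equivalent: (i) P_I(W) = 0 for every type-k subset I; (ii) dim_K(W ∩ E₂) ≥ k + 1 or dim_K(W ∩ E₁) ≥ p − k + 1. (This is the set-theoretic content of Lemma 4.2: the determinantal locus S_k, defined by the vanishing of all Plücker coordinates of type k, is the union of the closure of V⁺_{(p−k−1,k+1)} = {W : dim(W ∩ E₂) ≥ k+1} and the closure of V⁻_{(p−k+1,k−1)} = {W : dim(W ∩ E₁) ≥ p−k+1}.) -/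
/-- The coordinate subspace of `Kⁿ` consisting of the vectors supported on the set of
coordinates satisfying `P`. -/
def coordSub (K : Type*) [Field K] (n : ℕ) (P : Fin n → Prop) : Submodule K (Fin n → K) where
  carrier := {x | ∀ i, ¬ P i → x i = 0}
  add_mem' := by
    intro a b ha hb i hi
    simp [ha i hi, hb i hi]
  zero_mem' := by intro i _; rfl
  smul_mem' := by
    intro c x hx i hi
    simp [hx i hi]

/-- For a matrix with independent rows, the dimension of the space of row vectors supported on `P`
and the rank of the columns off `P` add up to the number of rows. -/
theorem finrank_rowSpace_inf_coordSub {K : Type*} [Field K] {n p : ℕ}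
    (M : Matrix (Fin p) (Fin n) K) (hind : LinearIndependent K (fun i : Fin p => M i))
    (P : Fin n → Prop) :
    Module.finrank K ↥(Submodule.span K (Set.range fun i : Fin p => M i) ⊓ coordSub K n P) +
      Module.finrank K (Submodule.span K (M.col '' {i | ¬ P i})) = p := by
  classical
  let N : Matrix (Fin p) {i // ¬ P i} K := M.submatrix id Subtype.val
  have hinj : Function.Injective M.vecMulLinear := Matrix.vecMul_injective_iff.2 hind
  have hmap : Submodule.span K (Set.range fun i : Fin p => M i) ⊓ coordSub K n P =
      (LinearMap.ker N.vecMulLinear).map M.vecMulLinear := by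
    have hr : Submodule.span K (Set.range fun i : Fin p => M i) = LinearMap.range M.vecMulLinear :=
      (range_vecMulLinear M).symm
    ext w
    rw [hr]
    constructor
    · rintro ⟨⟨x, rfl⟩, hx⟩
      exact ⟨x, funext fun i => hx i.1 i.2, rfl⟩
    · rintro ⟨x, hx, rfl⟩
      exact ⟨⟨x, rfl⟩, fun i hi => congrFun hx ⟨i, hi⟩⟩
  have hcol : M.col '' {i | ¬ P i} = Set.range N.col := by
    ext w
    constructor
    · rintro ⟨i, hi, rfl⟩
      exact ⟨⟨i, hi⟩, rfl⟩
    · rintro ⟨i, rfl⟩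
      exact ⟨i.1, i.2, rfl⟩
  have hrn := LinearMap.finrank_range_add_finrank_ker N.vecMulLinear
  rw [range_vecMulLinear, ← Matrix.rank_eq_finrank_span_row,
    Matrix.rank_eq_finrank_span_cols, Module.finrank_fin_fun] at hrn
  rw [hmap, hcol, ← (Submodule.equivMapOfInjective _ hinj _).finrank_eq]
  omega

theorem LinearIndepOn.finrank_span_image_finset {K V ι : Type*} [Field K] [AddCommGroup V]
    [Module K V] {v : ι → V} {I : Finset ι} (h : LinearIndepOn K v (I : Set ι)) :
    Module.finrank K (Submodule.span K (v '' I)) = I.card := by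
  have := finrank_span_eq_card (R := K) h
  rw [← Set.image_eq_range] at this
  simpa using this

/-- A linearly independent family indexed by a finset extends inside a larger finset to one with
the same span. -/
theorem LinearIndepOn.exists_finset_extension {K V ι : Type*} [Field K] [AddCommGroup V]
    [Module K V] {v : ι → V} {I T : Finset ι} (h : LinearIndepOn K v (I : Set ι)) (hIT : I ⊆ T) :
    ∃ J : Finset ι, I ⊆ J ∧ J ⊆ T ∧ LinearIndepOn K v (J : Set ι) ∧
      Submodule.span K (v '' J) = Submodule.span K (v '' T) := by
  obtain ⟨b, hbT, hIb, hspan, hb⟩ := exists_linearIndepOn_extension h (Finset.coe_subset.2 hIT)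
  lift b to Finset ι using T.finite_toSet.subset hbT
  exact ⟨b, Finset.coe_subset.1 hIb, Finset.coe_subset.1 hbT, hb,
    le_antisymm (Submodule.span_mono (Set.image_mono hbT)) (Submodule.span_le.2 hspan)⟩

/-- Given a partition of a family of vectors into two finsets, a basis of the span with `k` vectors
from the second part exists when the ranks of both parts allow it. -/
theorem exists_linearIndepOn_card_filter_eq {K V ι : Type*} [Field K] [AddCommGroup V]
    [Module K V] [Fintype ι] [DecidableEq ι] (v : ι → V) (P : ι → Prop) [DecidablePred P] {k p : ℕ}
    (hk : k ≤ p) (hp : Module.finrank K (Submodule.span K (Set.range v)) = p)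
    (h₁ : p - k ≤ Module.finrank K (Submodule.span K (v '' {i | ¬ P i})))
    (h₂ : k ≤ Module.finrank K (Submodule.span K (v '' {i | P i}))) :
    ∃ I : Finset ι, I.card = p ∧ (I.filter P).card = k ∧ LinearIndepOn K v (I : Set ι) := by
  obtain ⟨X, -, hX, hXi, hXs⟩ := LinearIndepOn.exists_finset_extension (K := K) (v := v)
    (I := ∅) (T := Finset.univ.filter (¬ P ·)) (by simp) (by simp)
  obtain ⟨Z, hXZ, -, hZi, hZs⟩ := hXi.exists_finset_extension (Finset.subset_univ X)
  have hXc : p - k ≤ X.card := by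
    rw [← hXi.finrank_span_image_finset, hXs]
    rwa [Finset.coe_filter_univ]
  have hZc : Z.card = p := by
    rw [← hZi.finrank_span_image_finset, hZs]
    rwa [Finset.coe_univ, Set.image_univ]
  have hZPi : LinearIndepOn K v ((Z.filter P : Finset ι) : Set ι) :=
    hZi.mono (Finset.coe_subset.2 (Finset.filter_subset _ _))
  obtain ⟨Y', hZY', hY', hYi', hYs'⟩ := hZPi.exists_finset_extension
    (Finset.filter_subset_filter P (Finset.subset_univ Z))
  have hYc' : k ≤ Y'.card := by
    rw [← hYi'.finrank_span_image_finset, hYs']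
    rwa [Finset.coe_filter_univ]
  have hXZc : X.card ≤ (Z.filter (¬ P ·)).card :=
    Finset.card_le_card fun i hi => Finset.mem_filter.2 ⟨hXZ hi, (Finset.mem_filter.1 (hX hi)).2⟩
  have hZP : (Z.filter P).card ≤ k := by
    have := Finset.card_filter_add_card_filter_not (s := Z) P
    omega
  obtain ⟨Y, hZY, hYY', hYc⟩ := Finset.exists_subsuperset_card_eq hZY' hZP hYc'
  have hYP : ∀ i ∈ Y, P i := fun i hi => (Finset.mem_filter.1 (hY' (hYY' hi))).2
  obtain ⟨I, hYI, hIT, hIi, hIs⟩ := (hYi'.mono (Finset.coe_subset.2 hYY')).exists_finset_extension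
    (Finset.subset_union_left (s₁ := Y) (s₂ := Z.filter (¬ P ·)))
  refine ⟨I, ?_, ?_, hIi⟩
  · have hZT : Z ⊆ Y ∪ Z.filter (¬ P ·) := by
      intro i hi
      by_cases h : P i
      · exact Finset.mem_union_left _ (hZY (Finset.mem_filter.2 ⟨hi, h⟩))
      · exact Finset.mem_union_right _ (Finset.mem_filter.2 ⟨hi, h⟩)
    have htop : Submodule.span K (v '' I) = Submodule.span K (Set.range v) := by
      refine le_antisymm (Submodule.span_mono (Set.image_subset_range _ _)) ?_
      rw [hIs, ← Set.image_univ, ← Finset.coe_univ, ← hZs]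
      exact Submodule.span_mono (Set.image_mono (Finset.coe_subset.2 hZT))
    rw [← hIi.finrank_span_image_finset, htop, hp]
  · have : I.filter P = Y := by
      ext i
      have h₃ := @hIT i
      have h₄ := @hYI i
      have h₅ := hYP i
      simp only [Finset.mem_union, Finset.mem_filter] at h₃ ⊢
      tauto
    rw [this, hYc]

/-- A Plücker coordinate is nonzero iff the columns it selects are linearly independent. -/
theorem det_submatrix_orderIsoOfFin_ne_zero_iff {K : Type*} [Field K] {n p : ℕ}
    (M : Matrix (Fin p) (Fin n) K) (I : Finset (Fin n)) (hI : I.card = p) :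
    (M.submatrix id fun t : Fin p => (I.orderIsoOfFin hI t).1).det ≠ 0 ↔
      LinearIndepOn K M.col (I : Set (Fin n)) := by
  rw [← isUnit_iff_ne_zero, ← Matrix.isUnit_iff_isUnit_det,
    ← Matrix.linearIndependent_cols_iff_isUnit]
  exact linearIndependent_equiv (I.orderIsoOfFin hI).toEquiv (f := fun i : I => M.col i)

/-- set-theoretic content of Lemma 4.2.  Let `K` be a field,
`0 < p < n`, `0 < s < n`, `E₁ = span(e₁,…,e_s)`, `E₂ = span(e_{s+1},…,e_n)` the coordinate
subspaces of `Kⁿ`, and let `W ⊆ Kⁿ` be a `p`-dimensional subspace whose basis is given by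
the rows of the `p × n` matrix `M`.  For a `p`-element subset `I ⊆ {1,…,n}` of type `k`
(i.e. `|I ∩ {s+1,…,n}| = k`), the Plücker coordinate `P_I(W)` is the determinant of the
`p × p` submatrix of `M` on the columns indexed by `I` (in increasing order). Then for
`0 ≤ k ≤ p`: all the type-`k` Plücker coordinates of `W` vanish iff
`dim(W ∩ E₂) ≥ k + 1` or `dim(W ∩ E₁) ≥ p − k + 1`. -/
theorem plucker_type_k_vanishing_iff
    (K : Type*) [Field K] (n s p : ℕ) (hp : 0 < p) (hpn : p < n) (hs : 0 < s) (hsn : s < n)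
    (W : Submodule K (Fin n → K)) (M : Matrix (Fin p) (Fin n) K)
    (hind : LinearIndependent K (fun i : Fin p => M i))
    (hspan : Submodule.span K (Set.range fun i : Fin p => M i) = W)
    (k : ℕ) (hk : k ≤ p) :
    (∀ (I : Finset (Fin n)) (hI : I.card = p),
        (I.filter fun i => s ≤ i.1).card = k →
        (M.submatrix id fun t : Fin p => (I.orderIsoOfFin hI t).1).det = 0) ↔
      (k + 1 ≤ Module.finrank K ↥(W ⊓ coordSub K n fun i => s ≤ i.1) ∨
        p - k + 1 ≤ Module.finrank K ↥(W ⊓ coordSub K n fun i => i.1 < s)) := by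
  subst hspan
  have hE₂ := finrank_rowSpace_inf_coordSub M hind fun i => s ≤ i.1
  have hE₁ := finrank_rowSpace_inf_coordSub M hind fun i => i.1 < s
  have hrank : Module.finrank K (Submodule.span K (Set.range M.col)) = p := by
    rw [← Matrix.rank_eq_finrank_span_cols, LinearIndependent.rank_matrix hind, Fintype.card_fin]
  have hnot : {i : Fin n | ¬ i.1 < s} = {i | s ≤ i.1} := by simp
  rw [hnot] at hE₁
  constructor
  · intro h
    by_contra! hcon
    obtain ⟨I, hI, hIk, hIi⟩ := exists_linearIndepOn_card_filter_eq M.col (fun i => s ≤ i.1) hk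
      hrank (by omega) (by omega)
    exact (det_submatrix_orderIsoOfFin_ne_zero_iff M I hI).2 hIi (h I hI hIk)
  · intro h I hI hIk
    by_contra hdet
    have hIi := (det_submatrix_orderIsoOfFin_ne_zero_iff M I hI).1 hdet
    have hle : ∀ (P : Fin n → Prop) [DecidablePred P],
        (I.filter P).card ≤ Module.finrank K (Submodule.span K (M.col '' {i | P i})) := by
      intro P _
      rw [← (hIi.mono (Finset.coe_subset.2
        (Finset.filter_subset P I))).finrank_span_image_finset]
      exact Submodule.finrank_mono (Submodule.span_mono (Set.image_mono fun i hi =>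
        (Finset.mem_filter.1 hi).2))
    have h₁ := hle fun i => ¬ s ≤ i.1
    have h₂ := hle fun i => s ≤ i.1
    have := Finset.card_filter_add_card_filter_not (s := I) fun i => s ≤ i.1
    omega
end

section
/- For every integer k with 0 ≤ k ≤ p, let I_k = {s−p+k+1, s−p+k+2, …, s+k} (a set of p consecutive integers). Then P_{I_k}(M) = (−1)^{k(p−k)} · ∏_{t=1}^{p−k} a_t^{p−k+1−t}, where the empty product (case k = p) equals 1. -/
open MvPolynomial

/-- The set of variables of the polynomial ring `R`:  `a k` encodes the pivot variable
`a_{k+1}` (`1 ≤ k+1 ≤ p`); `row k t` encodes the variable `ξ^{(k+1)}_{t+1, s+1−(k+1)}`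
(with `1 ≤ t+1 ≤ p−(k+1)`); `col k t` encodes the variable `ξ^{(k+1)}_{p+1−(k+1), t+1}`
(with `1 ≤ t+1 ≤ s−(k+1)`).  All indices are encoded 0-based. -/
inductive MCVar (p s : ℕ) : Type
  | a : Fin p → MCVar p s
  | row : (k : Fin p) → Fin (p - (k.1 + 1)) → MCVar p s
  | col : (k : Fin p) → Fin (s - (k.1 + 1)) → MCVar p s

/-- The polynomial ring `R` over `ℤ` in the variables `a₁, …, a_p`,
`ξ^{(k)}_{t, s+1−k}` (`1 ≤ t ≤ p−k`) and `ξ^{(k)}_{p+1−k, t}` (`1 ≤ t ≤ s−k`). -/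
abbrev MCRing (p s : ℕ) : Type := MvPolynomial (MCVar p s) ℤ

/-- The vector `v^{k+1} ∈ R^p`: its `t+1`-st entry equals `ξ^{(k+1)}_{t+1, s+1-(k+1)}` for
`t+1 ≤ p−(k+1)`, equals `1` for `t+1 = p+1−(k+1)`, and `0` afterwards. -/
noncomputable def MCv (p s : ℕ) (k : Fin p) : Fin p → MCRing p s := fun t =>
  if h : t.1 + 1 ≤ p - (k.1 + 1) then X (MCVar.row k ⟨t.1, by omega⟩)
  else if t.1 + 1 = p - k.1 then 1 else 0

/-- The vector `w^{k+1} ∈ R^s`: its `t+1`-st entry equals `ξ^{(k+1)}_{p+1-(k+1), t+1}` for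
`t+1 ≤ s−(k+1)`, equals `1` for `t+1 = s+1−(k+1)`, and `0` afterwards. -/
noncomputable def MCw (p s : ℕ) (k : Fin p) : Fin s → MCRing p s := fun t =>
  if h : t.1 + 1 ≤ s - (k.1 + 1) then X (MCVar.col k ⟨t.1, by omega⟩)
  else if t.1 + 1 = s - k.1 then 1 else 0

/-- The `p × s` matrix `Z = Σ_{k=1}^p (∏_{t=1}^k a_t) · v^k (w^k)^T`. -/
noncomputable def MCZ (p s : ℕ) : Matrix (Fin p) (Fin s) (MCRing p s) :=
  Matrix.of fun i j =>
    ∑ k : Fin p, (∏ t ∈ Finset.Iic k, X (MCVar.a t)) * MCv p s k i * MCw p s k j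

/-- The `p × (s+p)` matrix `M = (Z | I_p)`. -/
noncomputable def MCM (p s : ℕ) : Matrix (Fin p) (Fin (s + p)) (MCRing p s) :=
  Matrix.of fun i j =>
    if h : j.1 < s then MCZ p s i ⟨j.1, h⟩ else if j.1 = s + i.1 then 1 else 0

/-- The monomial `∏_{t=1}^{p−k} a_t^{p−k+1−t}`. -/
noncomputable def MCmono (p s : ℕ) (k : ℕ) : MCRing p s :=
  ∏ t : Fin p, if t.1 < p - k then X (MCVar.a t) ^ (p - k - t.1) else 1

theorem finRotate_pow_apply_val (n m : ℕ) (j : Fin n) :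
    ((finRotate n ^ m) j).1 = (j.1 + m) % n := by
  obtain _ | n := n
  · exact j.elim0
  induction m with
  | zero => simp [Nat.mod_eq_of_lt j.2]
  | succ m ih =>
    rw [pow_succ', Equiv.Perm.mul_apply, finRotate_apply, Fin.val_add, ih, Fin.val_one', ← Nat.add_mod, add_assoc]

theorem sign_finRotate_add_pow (m k : ℕ) :
    Equiv.Perm.sign (finRotate (m + k) ^ m) = (-1) ^ (k * m) := by
  rw [map_pow, sign_finRotate, ← pow_mul]
  obtain _ | m := m
  · simp
  have h : (m + 1 + k - 1) * (m + 1) = k * (m + 1) + m * (m + 1) := by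
    rw [show m + 1 + k - 1 = k + m by omega]; ring
  rw [h, pow_add, (Nat.even_mul_succ_self m).neg_one_pow, mul_one]

/-- A matrix whose last columns are standard basis vectors has, up to the sign of the block swap,
the determinant of the complementary lower left block. -/
theorem det_eq_of_right_cols_eq_one {R : Type*} [CommRing R] (m k : ℕ)
    (A : Matrix (Fin (m + k)) (Fin (m + k)) R)
    (hA : ∀ i (j : Fin k), A i (Fin.natAdd m j) = if i.1 = j.1 then 1 else 0) :
    A.det = (-1) ^ (k * m) *
      (Matrix.of fun i j : Fin m => A ⟨k + i.1, by omega⟩ (Fin.castAdd k j)).det := by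
  let e : Fin k ⊕ Fin m ≃ Fin (m + k) := finSumFinEquiv.trans (finCongr (add_comm k m))
  let B := (A.submatrix id (finRotate (m + k) ^ m)).submatrix e e
  have hl (j : Fin k) : (finRotate (m + k) ^ m) (e (Sum.inl j)) = Fin.natAdd m j := by
    ext
    rw [finRotate_pow_apply_val, Nat.mod_eq_of_lt (by simp [e]; omega)]
    simp [e, add_comm]
  have hr (j : Fin m) : (finRotate (m + k) ^ m) (e (Sum.inr j)) = Fin.castAdd k j := by
    ext
    rw [finRotate_pow_apply_val]
    have : (e (Sum.inr j)).1 + m = j.1 + (m + k) := by simp [e]; omega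
    rw [this, Nat.add_mod_right, Nat.mod_eq_of_lt (by omega)]
    simp
  have h : B = Matrix.fromBlocks 1 B.toBlocks₁₂ 0
      (Matrix.of fun i j : Fin m => A ⟨k + i.1, by omega⟩ (Fin.castAdd k j)) := by
    ext (i | i) (j | j)
    · simp only [B, Matrix.submatrix_apply, hl, hA, Matrix.fromBlocks_apply₁₁, Matrix.one_apply,
        id, Fin.ext_iff]
      simp [e]
    · simp [Matrix.toBlocks₁₂]
    · simp only [B, Matrix.submatrix_apply, hl, hA, Matrix.fromBlocks_apply₂₁, Matrix.zero_apply,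
        id]
      rw [if_neg]
      simp [e]; omega
    · simp only [B, Matrix.submatrix_apply, hr, Matrix.fromBlocks_apply₂₂, id]
      rfl
  have hdet : B.det = (-1) ^ (k * m) * A.det := by
    rw [Matrix.det_submatrix_equiv_self, Matrix.det_permute', sign_finRotate_add_pow]
    simp
  rw [h, Matrix.det_fromBlocks_zero₂₁, Matrix.det_one, one_mul] at hdet
  rw [hdet, ← mul_assoc, ← pow_add, (Even.add_self _).neg_one_pow, one_mul]

/-- The determinant of `V * diagonal d * W` when `V` and `W` vanish below the antidiagonal and have
ones on it. -/
theorem det_sum_mul_of_antitriangular {R : Type*} [CommRing R] (m : ℕ)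
    (V W : Fin m → Fin m → R) (d : Fin m → R)
    (hV : ∀ l i, m < l.1 + i.1 + 1 → V l i = 0) (hV₁ : ∀ l i, l.1 + i.1 + 1 = m → V l i = 1)
    (hW : ∀ l i, m < l.1 + i.1 + 1 → W l i = 0) (hW₁ : ∀ l i, l.1 + i.1 + 1 = m → W l i = 1) :
    (Matrix.of fun i j => ∑ l, d l * V l i * W l j).det = ∏ l, d l := by
  have h : (Matrix.of fun i j => ∑ l, d l * V l i * W l j) =
      (Matrix.of fun i l : Fin m => V l.rev i) * Matrix.diagonal (fun l => d l.rev) *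
        (Matrix.of fun l j : Fin m => W l.rev j) := by
    ext i j
    rw [Matrix.mul_apply, Matrix.of_apply, ← Equiv.sum_comp Fin.revPerm]
    simp [Matrix.mul_diagonal, mul_comm]
  rw [h, Matrix.det_mul, Matrix.det_mul, Matrix.det_diagonal,
    Matrix.det_of_isUpperTriangular (M := Matrix.of fun i l : Fin m => V l.rev i),
    Matrix.det_of_isLowerTriangular (M := Matrix.of fun l j : Fin m => W l.rev j),
    Finset.prod_eq_one (f := fun i => Matrix.of (fun i l : Fin m => V l.rev i) i i),
    Finset.prod_eq_one (f := fun i => Matrix.of (fun l j : Fin m => W l.rev j) i i),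
    one_mul, mul_one]
  · exact Equiv.prod_comp Fin.revPerm d
  · intro i _
    exact hW₁ _ _ (by simp [Fin.val_rev]; omega)
  · intro i _
    exact hV₁ _ _ (by simp [Fin.val_rev]; omega)
  · intro i j hij
    have : i.1 < j.1 := hij
    exact hW _ _ (by simp [Fin.val_rev]; omega)
  · intro i j hij
    have : j.1 < i.1 := hij
    exact hV _ _ (by simp [Fin.val_rev]; omega)

theorem prod_prod_Iic_castAdd {R : Type*} [CommMonoid R] (m k : ℕ) (x : Fin (m + k) → R) :
    ∏ l : Fin m, ∏ t ∈ Finset.Iic (Fin.castAdd k l), x t =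
      ∏ t : Fin (m + k), if t.1 < m then x t ^ (m - t.1) else 1 := by
  have h (l : Fin m) : ∏ t ∈ Finset.Iic (Fin.castAdd k l), x t =
      ∏ t, if t.1 ≤ l.1 then x t else 1 := by
    rw [← Finset.prod_filter]
    congr 1
    ext t
    simp [Fin.le_def]
  simp_rw [h]
  rw [Finset.prod_comm]
  refine Finset.prod_congr rfl fun t _ => ?_
  rw [← Finset.prod_filter, Finset.prod_const]
  split_ifs with ht
  · have : Finset.univ.filter (fun l : Fin m => t.1 ≤ l.1) = Finset.Ici ⟨t.1, ht⟩ := by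
      ext l
      simp [Fin.le_def]
    rw [this, Fin.card_Ici]
  · rw [Finset.filter_false_of_mem (fun l _ => by omega)]
    simp

/-- from the proof of Lemma 3.2.  For `0 ≤ k ≤ p`, let
`I_k = {s−p+k+1, …, s+k}` (a set of `p` consecutive integers, 1-indexed; its increasing
enumeration is `j ↦ s−p+k+j` 0-indexed).  Then
`P_{I_k}(M) = (−1)^{k(p−k)} · ∏_{t=1}^{p−k} a_t^{p−k+1−t}`. -/
theorem plucker_of_Ik
    (p s : ℕ) (hp : 1 ≤ p) (hs : p ≤ s) (k : ℕ) (hk : k ≤ p) :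
    (Matrix.submatrix (MCM p s) id
        (fun j : Fin p => (⟨s - p + k + j.1, by have := j.2; omega⟩ : Fin (s + p)))).det =
      (-1) ^ (k * (p - k)) * MCmono p s k := by
  obtain ⟨m, rfl⟩ : ∃ m, p = m + k := ⟨p - k, by omega⟩
  rw [det_eq_of_right_cols_eq_one m k, MCmono]
  · simp only [Nat.add_sub_cancel]
    rw [← prod_prod_Iic_castAdd m k (fun t => (X (MCVar.a t) : MCRing (m + k) s))]
    congr 1
    rw [← det_sum_mul_of_antitriangular m
      (fun l i => MCv (m + k) s (Fin.castAdd k l) ⟨k + i.1, by omega⟩)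
      (fun l j => MCw (m + k) s (Fin.castAdd k l) ⟨s - m + j.1, by omega⟩)]
    · congr 1
      ext1 i j
      have hj : s - (m + k) + k + j.1 < s := by omega
      have hj' : s - (m + k) + k + j.1 = s - m + j.1 := by omega
      simp only [Matrix.of_apply, Matrix.submatrix_apply, MCM, MCZ, id, Fin.val_castAdd, hj,
        dif_pos]
      have h0 (l : Fin k) : MCv (m + k) s (Fin.natAdd m l) ⟨k + i.1, by omega⟩ = 0 := by
        rw [MCv, dif_neg (by simp; omega), if_neg (by simp; omega)]
      simp only [hj', Fin.sum_univ_add, h0, mul_zero, zero_mul, Finset.sum_const_zero, add_zero]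
    · intro l i h
      rw [MCv, dif_neg (by simp; omega), if_neg (by simp; omega)]
    · intro l i h
      rw [MCv, dif_neg (by simp; omega), if_pos (by simp; omega)]
    · intro l i h
      rw [MCw, dif_neg (by simp; omega), if_neg (by simp; omega)]
    · intro l i h
      rw [MCw, dif_neg (by simp; omega), if_pos (by simp; omega)]
  · intro i j
    have hj : s - (m + k) + k + (m + j.1) = s + j.1 := by omega
    simp [MCM, hj, eq_comm]
end

section
/- For all integers k, ν with 0 ≤ k ≤ p−1 and 1 ≤ ν ≤ s−p+k, let I = {ν} ∪ {s−p+k+2, s−p+k+3, …, s+k}. Then P_I(M) = (−1)^{k(p−k)} · ξ^{(p−k)}_{k+1, ν} · ∏_{t=1}^{p−k} a_t^{p−k+1−t}. -/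
open MvPolynomial

lemma val_finRotate_pow (n k : ℕ) (i : Fin n) :
    (((finRotate n) ^ k) i).1 = (i.1 + k) % n := by
  induction k with
  | zero => simp [Nat.mod_eq_of_lt i.2]
  | succ k ih =>
    obtain ⟨n, rfl⟩ : ∃ l, n = l + 1 := ⟨n - 1, by have := i.2; omega⟩
    rw [pow_succ', Equiv.Perm.mul_apply, finRotate_apply, Fin.val_add, ih, Fin.val_one',
      ← Nat.add_mod, add_assoc]

lemma sign_finRotate_pow (m k : ℕ) :
    Equiv.Perm.sign ((finRotate (m + k)) ^ k) = (-1) ^ (k * m) := by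
  rw [map_pow, sign_finRotate, ← pow_mul]
  obtain rfl | ⟨l, rfl⟩ : k = 0 ∨ ∃ l, k = l + 1 := by cases k <;> simp
  · simp
  · have h : (m + (l + 1) - 1) * (l + 1) = (l + 1) * m + l * (l + 1) := by
      rw [← add_assoc, Nat.add_sub_cancel]; ring
    rw [h, pow_add, (Nat.even_mul_succ_self l).neg_one_pow, mul_one]

/-- A determinant whose last `k` columns are the first `k` standard basis vectors. -/
lemma Matrix.det_of_last_cols_eq_one {R : Type*} [CommRing R] (m k : ℕ)
    (N : Matrix (Fin (m + k)) (Fin (m + k)) R)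
    (h : ∀ i j : Fin (m + k), m ≤ j.1 → N i j = if j.1 = m + i.1 then 1 else 0) :
    N.det = (-1) ^ (k * m) * (N.submatrix (fun i : Fin m => i.addNat k) (Fin.castAdd k)).det := by
  set σ := (finRotate (m + k)) ^ k with hσ
  have hl : ∀ i : Fin m, σ (Fin.castAdd k i) = i.addNat k := fun i => by
    ext
    rw [hσ, val_finRotate_pow]
    exact Nat.mod_eq_of_lt (by simp)
  have hr : ∀ i : Fin k, (σ (Fin.natAdd m i)).1 = i.1 := fun i => by
    rw [hσ, val_finRotate_pow, Fin.val_natAdd, show m + i.1 + k = i.1 + (m + k) by ring,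
      Nat.add_mod_right, Nat.mod_eq_of_lt (by omega)]
  have key : (N.submatrix σ id).det =
      (N.submatrix (fun i : Fin m => i.addNat k) (Fin.castAdd k)).det := by
    rw [← Matrix.det_submatrix_equiv_self finSumFinEquiv]
    have hb : (N.submatrix σ id).submatrix finSumFinEquiv finSumFinEquiv =
        Matrix.fromBlocks (N.submatrix (fun i : Fin m => i.addNat k) (Fin.castAdd k)) 0
          (N.submatrix (fun i : Fin k => σ (Fin.natAdd m i)) (Fin.castAdd k)) 1 := by
      ext (i | i) (j | j)
      · simp [hl]
      · simp only [Matrix.submatrix_apply, finSumFinEquiv_apply_left, finSumFinEquiv_apply_right,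
          id, hl, Matrix.fromBlocks_apply₁₂, Matrix.zero_apply]
        rw [h _ _ (by simp), if_neg]
        have := j.2
        simp
        omega
      · simp
      · simp only [Matrix.submatrix_apply, finSumFinEquiv_apply_right, id,
          Matrix.fromBlocks_apply₂₂, Matrix.one_apply]
        rw [h _ _ (by simp), hr]
        simp [Fin.ext_iff, eq_comm]
    rw [hb, Matrix.det_fromBlocks_zero₁₂, Matrix.det_one, mul_one]
  rw [← key, Matrix.det_permute, sign_finRotate_pow, ← mul_assoc]
  simp [← mul_pow]

lemma MCv_eq_zero {p s : ℕ} {k t : Fin p} (h : p ≤ t.1 + k.1) : MCv p s k t = 0 := by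
  have := k.2
  rw [MCv, dif_neg (by omega), if_neg (by omega)]

lemma MCv_eq_one {p s : ℕ} {k t : Fin p} (h : t.1 + k.1 + 1 = p) : MCv p s k t = 1 := by
  rw [MCv, dif_neg (by omega), if_pos (by omega)]

lemma MCw_eq_zero {p s : ℕ} {k : Fin p} {t : Fin s} (h : s ≤ t.1 + k.1) :
    MCw p s k t = 0 := by
  have := t.2
  rw [MCw, dif_neg (by omega), if_neg (by omega)]

lemma MCw_eq_one {p s : ℕ} {k : Fin p} {t : Fin s} (h : t.1 + k.1 + 1 = s) :
    MCw p s k t = 1 := by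
  rw [MCw, dif_neg (by omega), if_pos (by omega)]

lemma prod_prod_Iic_eq_MCmono (m k s : ℕ) :
    ∏ l : Fin m, ∏ t ∈ Finset.Iic (Fin.castAdd k l), (X (MCVar.a t) : MCRing (m + k) s) =
      MCmono (m + k) s k := by
  have h : ∀ l : Fin m, ∏ t ∈ Finset.Iic (Fin.castAdd k l), (X (MCVar.a t) : MCRing (m + k) s) =
      ∏ t : Fin (m + k), if t ≤ Fin.castAdd k l then X (MCVar.a t) else 1 := fun l => by
    rw [← Finset.prod_filter]
    congr 1
    ext
    simp
  simp_rw [h]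
  rw [Finset.prod_comm, MCmono]
  refine Finset.prod_congr rfl fun t _ => ?_
  rw [Nat.add_sub_cancel, ← Finset.prod_filter, Finset.prod_const]
  split_ifs with ht
  · congr 1
    rw [show (Finset.univ.filter fun l : Fin m => t ≤ Fin.castAdd k l) = Finset.Ici ⟨t.1, ht⟩ by
      ext; simp [Fin.le_def], Fin.card_Ici]
  · rw [Finset.filter_false_of_mem, Finset.card_empty, pow_zero]
    intro l _ hl
    have := l.2
    simp only [Fin.le_def, Fin.val_castAdd] at hl
    omega

/-- A minor of `Z` on the last `m` rows, for columns `c` of which all but the first are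
the last `m - 1` columns. -/
lemma det_MCZ_submatrix (m k s : ℕ) (c : Fin m → Fin s)
    (hc : ∀ j : Fin m, j.1 ≠ 0 → (c j).1 + m = s + j.1) (hm : 0 < m) :
    ((MCZ (m + k) s).submatrix (fun i : Fin m => i.addNat k) c).det =
      MCw (m + k) s (Fin.castAdd k ⟨m - 1, by omega⟩) (c ⟨0, hm⟩) * MCmono (m + k) s k := by
  let V : Matrix (Fin m) (Fin m) (MCRing (m + k) s) :=
    Matrix.of fun i l => MCv (m + k) s (Fin.castAdd k l.rev) (i.addNat k)
  let d : Fin m → MCRing (m + k) s := fun l =>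
    ∏ t ∈ Finset.Iic (Fin.castAdd k l.rev), X (MCVar.a t)
  let W : Matrix (Fin m) (Fin m) (MCRing (m + k) s) :=
    Matrix.of fun l j => MCw (m + k) s (Fin.castAdd k l.rev) (c j)
  have hfac : (MCZ (m + k) s).submatrix (fun i : Fin m => i.addNat k) c =
      V * Matrix.diagonal d * W := by
    ext1 i j
    rw [Matrix.mul_apply]
    simp only [Matrix.mul_diagonal, Matrix.submatrix_apply, MCZ, Matrix.of_apply, V, d, W]
    rw [Fin.sum_univ_add, ← Equiv.sum_comp Fin.revPerm,
      Finset.sum_eq_zero (s := (Finset.univ : Finset (Fin k))), add_zero]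
    · refine Finset.sum_congr rfl fun l _ => ?_
      rw [Fin.revPerm_apply]
      ring
    · intro l _
      rw [MCv_eq_zero (by simp; omega), mul_zero, zero_mul]
  have hV : V.det = 1 := by
    rw [Matrix.det_of_isUpperTriangular]
    · refine Finset.prod_eq_one fun i _ => MCv_eq_one ?_
      simp [Fin.val_rev]
      omega
    · intro i l hl
      refine MCv_eq_zero ?_
      simp only [id, Fin.lt_def] at hl
      simp [Fin.val_rev]
      omega
  have hW : W.det = MCw (m + k) s (Fin.castAdd k ⟨m - 1, by omega⟩) (c ⟨0, hm⟩) := by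
    rw [Matrix.det_of_isLowerTriangular]
    · rw [Finset.prod_eq_single ⟨0, hm⟩]
      · simp only [W, Matrix.of_apply]
        congr 2
      · intro j _ hj
        have hj' : j.1 ≠ 0 := fun h => hj (Fin.ext h)
        have := hc j hj'
        refine MCw_eq_one ?_
        simp [Fin.val_rev]
        omega
      · simp
    · intro l j hl
      have hl' : l < j := hl
      rw [Fin.lt_def] at hl'
      have := hc j (by omega)
      refine MCw_eq_zero ?_
      simp [Fin.val_rev]
      omega
  rw [hfac, Matrix.det_mul, Matrix.det_mul, hV, hW, Matrix.det_diagonal, one_mul, mul_comm,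
    ← prod_prod_Iic_eq_MCmono, ← Equiv.prod_comp Fin.revPerm d]
  simp [d]

/-- from the proof of Lemma 3.2.  For `0 ≤ k ≤ p−1` and
`1 ≤ ν ≤ s−p+k`, let `I = {ν} ∪ {s−p+k+2, …, s+k}` (1-indexed; its increasing enumeration,
0-indexed, sends `j = 0` to `ν−1` and `j ≥ 1` to `s−p+k+j`).  Then
`P_I(M) = (−1)^{k(p−k)} · ξ^{(p−k)}_{k+1, ν} · ∏_{t=1}^{p−k} a_t^{p−k+1−t}`.
(Here `ξ^{(p−k)}_{k+1, ν}` is the variable `MCVar.col ⟨p−k−1,_⟩ ⟨ν−1,_⟩`, since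
`k+1 = p+1−(p−k)`.) -/
theorem plucker_of_Ik_mu_nu
    (p s : ℕ) (hp : 1 ≤ p) (hs : p ≤ s) (k ν : ℕ)
    (hk : k ≤ p - 1) (hν1 : 1 ≤ ν) (hν2 : ν ≤ s - p + k) :
    (Matrix.submatrix (MCM p s) id
        (fun j : Fin p =>
          if _ : j.1 = 0 then (⟨ν - 1, by omega⟩ : Fin (s + p))
          else ⟨s - p + k + j.1, by have := j.2; omega⟩)).det =
      (-1) ^ (k * (p - k)) *
        MvPolynomial.X (MCVar.col (⟨p - k - 1, by omega⟩ : Fin p)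
          ⟨ν - 1, show ν - 1 < s - (p - k - 1 + 1) by omega⟩) *
        MCmono p s k := by
  obtain ⟨m, rfl⟩ : ∃ m, p = m + k := ⟨p - k, by omega⟩
  have hm : 0 < m := by omega
  have hmk : m + k - k = m := by omega
  rw [Matrix.det_of_last_cols_eq_one, mul_assoc]
  · congr 1
    · rw [hmk]
    let c : Fin m → Fin s := fun j =>
      if j.1 = 0 then ⟨ν - 1, by omega⟩ else ⟨s - m + j.1, by have := j.2; omega⟩
    have hc : ∀ j : Fin m, j.1 ≠ 0 → (c j).1 + m = s + j.1 := fun j hj => by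
      simp only [c, if_neg hj]
      omega
    refine Eq.trans ?_ ((det_MCZ_submatrix m k s c hc hm).trans ?_)
    · congr 1
      ext1 i j
      simp only [Matrix.submatrix_apply, MCM, Matrix.of_apply, id]
      have hj := j.2
      by_cases h0 : j.1 = 0
      · have hv : ν - 1 < s := by omega
        simp [h0, c, hv]
      · have hv : s - (m + k) + k + j.1 < s := by omega
        simp only [Fin.val_castAdd, h0, c, dite_false, if_false, hv, dite_true]
        congr 2
        omega
    · congr 1
      simp only [MCw, c, if_true]
      rw [dif_pos (by simp; omega)]
      congr! 3
      all_goals simp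
  · intro i j hj
    have hj0 : j.1 ≠ 0 := by omega
    simp only [Matrix.submatrix_apply, MCM, Matrix.of_apply, id, hj0, dite_false]
    rw [dif_neg (by omega)]
    congr 1
    simp only [eq_iff_iff]
    omega
end

section
/- For all integers k, μ with 1 ≤ k ≤ p−1 and s+1 ≤ μ ≤ s+k, let I = {s+k+1} ∪ ({s−p+k+1, s−p+k+2, …, s+k} \ {μ}). Then P_I(M) = (−1)^{k(p−k)+s+k+1−μ} · ξ^{(p−k)}_{μ−s, s−p+k+1} · ∏_{t=1}^{p−k} a_t^{p−k+1−t}. -/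
open MvPolynomial

open Matrix in
/-- Only the first `q + 1` summands of `Z` meet its last `q + 1` columns, so on the row `m`
together with the last `q` rows the minor factors as an upper triangular matrix, a diagonal
matrix and a lower unitriangular matrix. -/
theorem MCZ_antidiagonal_minor (p s q : ℕ) (hq : q < p) (hs : p ≤ s) (m : ℕ)
    (hm : m < p - (q + 1)) (r : Fin (q + 1) → Fin p) (hr0 : (r 0).1 = m)
    (hr : ∀ i, i ≠ 0 → (r i).1 = p - (q + 1) + i.1) (c : Fin (q + 1) → Fin s)
    (hc : ∀ j, (c j).1 = s - (q + 1) + j.1) :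
    ((MCZ p s).submatrix r c).det =
      X (MCVar.row ⟨q, hq⟩ ⟨m, hm⟩) *
        ∏ j : Fin (q + 1), ∏ t ∈ Finset.Iic (⟨q - j.1, by omega⟩ : Fin p), X (MCVar.a t) := by
  let e : Fin (q + 1) → Fin p := fun j => ⟨q - j.1, by omega⟩
  let A : Fin (q + 1) → MCRing p s := fun j => ∏ t ∈ Finset.Iic (e j), X (MCVar.a t)
  let V : Matrix (Fin (q + 1)) (Fin (q + 1)) (MCRing p s) := of fun i j => MCv p s (e j) (r i)
  let W : Matrix (Fin (q + 1)) (Fin (q + 1)) (MCRing p s) := of fun j i => MCw p s (e j) (c i)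
  have he : Function.Injective e := by
    intro i j h
    have := congrArg Fin.val h
    simp only [e] at this
    omega
  have hfac : (MCZ p s).submatrix r c = V * diagonal A * W := by
    ext i j : 1
    rw [mul_apply]
    simp only [mul_diagonal]
    symm
    refine Fintype.sum_of_injective e he _ _ (fun l hl => ?_) (fun l => ?_)
    · have hl' : q < l.1 := by
        by_contra h
        exact hl ⟨⟨q - l.1, by omega⟩, Fin.ext (by simp only [e]; omega)⟩
      have := hc j
      have : MCw p s l (c j) = 0 := by
        unfold MCw
        rw [dif_neg (by omega), if_neg (by omega)]
      rw [this, mul_zero]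
    · simp only [V, W, A, of_apply]
      ring
  have hV : V.det = X (MCVar.row ⟨q, hq⟩ ⟨m, hm⟩) := by
    have htri : V.IsUpperTriangular := by
      intro i j hij
      have hij' : j.1 < i.1 := hij
      have := hr i (by rintro rfl; simp at hij')
      simp only [V, of_apply, MCv, e]
      rw [dif_neg (by omega), if_neg (by omega)]
    rw [det_of_isUpperTriangular htri, Fin.prod_univ_succ]
    have h0 : V 0 0 = X (MCVar.row ⟨q, hq⟩ ⟨m, hm⟩) := by
      simp only [V, of_apply, MCv, e, Fin.val_zero, Nat.sub_zero, hr0]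
      rw [dif_pos (by omega)]
    have h1 : ∀ i : Fin q, V i.succ i.succ = 1 := by
      intro i
      have := hr i.succ (Fin.succ_ne_zero i)
      have := Fin.val_succ i
      simp only [V, of_apply, MCv, e]
      rw [dif_neg (by omega), if_pos (by omega)]
    simp [h0, h1]
  have hW : W.det = 1 := by
    have htri : W.IsLowerTriangular := by
      intro i j hij
      have hij' : i.1 < j.1 := hij
      have := hc j
      simp only [W, of_apply, MCw, e]
      rw [dif_neg (by omega), if_neg (by omega)]
    rw [det_of_isLowerTriangular _ htri]
    refine Finset.prod_eq_one fun i _ => ?_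
    have := hc i
    simp only [W, of_apply, MCw, e]
    rw [dif_neg (by omega), if_pos (by omega)]
  rw [hfac, det_mul, det_mul, det_diagonal, hV, hW, mul_one]

theorem MCM_apply_of_val_eq (p s : ℕ) (i : Fin p) (j : Fin (s + p)) (c : Fin s)
    (h : j.1 = c.1) : MCM p s i j = MCZ p s i c := by
  simp only [MCM, Matrix.of_apply]
  rw [dif_pos (h ▸ c.2)]
  congr 1
  exact Fin.ext h

theorem prod_Iic_eq_MCmono (p s k q : ℕ) (hp : p = k + (q + 1)) :
    ∏ j : Fin (q + 1), ∏ t ∈ Finset.Iic (⟨q - j.1, by omega⟩ : Fin p),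
      (X (MCVar.a t) : MCRing p s) = MCmono p s k := by
  have hIic : ∀ j : Fin (q + 1), Finset.Iic (⟨q - j.1, by omega⟩ : Fin p) =
      Finset.univ.filter fun t : Fin p => t.1 ≤ q - j.1 := by
    intro j
    ext t
    simp [Fin.le_def]
  simp only [hIic, Finset.prod_filter]
  rw [Finset.prod_comm]
  refine Finset.prod_congr rfl fun t _ => ?_
  rw [Fin.prod_univ_eq_prod_range
    (fun j => if t.1 ≤ q - j then (X (MCVar.a t) : MCRing p s) else 1), ← Finset.prod_filter,
    Finset.prod_const]
  split_ifs with ht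
  · have : (Finset.range (q + 1)).filter (fun j => t.1 ≤ q - j) = Finset.range (p - k - t.1) := by
      ext j
      simp only [Finset.mem_filter, Finset.mem_range]
      omega
    rw [this, Finset.card_range]
  · have : (Finset.range (q + 1)).filter (fun j => t.1 ≤ q - j) = ∅ := by
      ext j
      simp only [Finset.mem_filter, Finset.mem_range, Finset.notMem_empty, iff_false]
      omega
    rw [this, Finset.card_empty, pow_zero]

theorem sign_finCycle {n : ℕ} (k : Fin n) :
    Equiv.Perm.sign (finCycle k) = (-1) ^ ((n - 1) * k.1) := by
  have : finCycle k = finRotate n ^ k.1 :=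
    DFunLike.coe_injective (by rw [finCycle_eq_finRotate_iterate, Equiv.Perm.coe_pow])
  rw [this, map_pow, sign_finRotate, pow_mul]

theorem val_cycleIcc {n : ℕ} (i j l : Fin n) (hij : i ≤ j) :
    (Fin.cycleIcc i j l).1 =
      if l.1 < i.1 then l.1 else if l.1 < j.1 then l.1 + 1 else if l.1 = j.1 then i.1 else l.1 := by
  have : NeZero n := .of_pos i.pos
  split_ifs with h₁ h₂ h₃
  · rw [Fin.cycleIcc_of_lt h₁]
  · rw [Fin.cycleIcc_of_ge_of_lt (not_lt.mp h₁) h₂, Fin.val_add_one_of_lt' (by omega)]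
  · rw [Fin.ext h₃, Fin.cycleIcc_of_last hij]
  · rw [Fin.cycleIcc_of_gt (Fin.lt_def.mpr (by omega))]

theorem val_finCycle {n : ℕ} (k l : Fin n) :
    (finCycle k l).1 = if l.1 + k.1 < n then l.1 + k.1 else l.1 + k.1 - n := by
  have : (finCycle k l).1 = (l.1 + k.1) % n := Fin.val_add l k
  rw [this]
  split_ifs with h
  · exact Nat.mod_eq_of_lt h
  · rw [Nat.mod_eq_sub_mod (by omega), Nat.mod_eq_of_lt (by omega)]

/-- from the proof of Lemma 3.2.  For `1 ≤ k ≤ p−1` and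
`s+1 ≤ μ ≤ s+k`, let `I = {s+k+1} ∪ ({s−p+k+1, …, s+k} \ {μ})` (1-indexed; its increasing
enumeration, 0-indexed, sends `j` to `s−p+k+j` while `s−p+k+j < μ−1`, then skips `μ−1`,
and sends `j = p−1` to `s+k`).  Then
`P_I(M) = (−1)^{k(p−k)+s+k+1−μ} · ξ^{(p−k)}_{μ−s, s−p+k+1} · ∏_{t=1}^{p−k} a_t^{p−k+1−t}`.
(Here `ξ^{(p−k)}_{μ−s, s−p+k+1}` is the variable `MCVar.row ⟨p−k−1,_⟩ ⟨μ−s−1,_⟩`, since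
`s−p+k+1 = s+1−(p−k)`.) -/
theorem plucker_of_Ik_star_mu_nu
    (p s : ℕ) (hp : 1 ≤ p) (hs : p ≤ s) (k μ : ℕ)
    (hk1 : 1 ≤ k) (hk2 : k ≤ p - 1) (hμ1 : s + 1 ≤ μ) (hμ2 : μ ≤ s + k) :
    (Matrix.submatrix (MCM p s) id
        (fun j : Fin p =>
          if _ : s - p + k + j.1 < μ - 1 then
            (⟨s - p + k + j.1, by have := j.2; omega⟩ : Fin (s + p))
          else if _ : j.1 = p - 1 then ⟨s + k, by omega⟩
          else ⟨s - p + k + j.1 + 1, by have := j.2; omega⟩)).det =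
      (-1) ^ (k * (p - k) + s + k + 1 - μ) *
        MvPolynomial.X (MCVar.row (⟨p - k - 1, by omega⟩ : Fin p)
          ⟨μ - s - 1, show μ - s - 1 < p - (p - k - 1 + 1) by omega⟩) *
        MCmono p s k := by
  obtain ⟨q, rfl⟩ : ∃ q, p = k + (q + 1) := ⟨p - k - 1, by omega⟩
  have hm : μ - s - 1 < k := by omega
  have hmq : μ - s - 1 < k + (q + 1) - (q + 1) := by omega
  set N := Matrix.submatrix (MCM (k + (q + 1)) s) id _ with hN
  let ρ : Equiv.Perm (Fin (k + (q + 1))) :=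
    Fin.cycleIcc ⟨μ - s - 1, by omega⟩ ⟨k, by omega⟩
  let γ : Equiv.Perm (Fin (k + (q + 1))) := finCycle ⟨q + 1, by omega⟩
  have hρ : ∀ l, (ρ l).1 = _ := fun l => val_cycleIcc _ _ l (Fin.le_def.mpr hm.le)
  have hγ : ∀ l, (γ l).1 = _ := fun l => val_finCycle _ l
  simp only at hρ hγ
  let r : Fin (q + 1) → Fin (k + (q + 1)) := fun i => ρ (Fin.natAdd k i)
  let c : Fin (q + 1) → Fin s := fun j => ⟨s - (q + 1) + j.1, by omega⟩
  have hblocks : (N.submatrix ρ γ).submatrix finSumFinEquiv finSumFinEquiv =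
      Matrix.fromBlocks 1 ((N.submatrix ρ γ).submatrix (Fin.castAdd _) (Fin.natAdd _)) 0
        ((MCZ (k + (q + 1)) s).submatrix r c) := by
    ext i j : 1
    rcases i with i | i <;> rcases j with j | j
    · have h₁ := hρ (Fin.castAdd _ i)
      have h₂ := hγ (Fin.castAdd _ j)
      simp only [Fin.val_castAdd] at h₁ h₂
      simp only [hN, MCM, Matrix.submatrix_apply, finSumFinEquiv_apply_left, id,
        Matrix.fromBlocks_apply₁₁, Matrix.of_apply, Matrix.one_apply, Fin.ext_iff]
      grind
    · rfl
    · have h₁ := hρ (Fin.natAdd _ i)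
      have h₂ := hγ (Fin.castAdd _ j)
      simp only [Fin.val_castAdd, Fin.val_natAdd] at h₁ h₂
      simp only [hN, MCM, Matrix.submatrix_apply, finSumFinEquiv_apply_left,
        finSumFinEquiv_apply_right, id, Matrix.fromBlocks_apply₂₁, Matrix.of_apply,
        Matrix.zero_apply]
      grind
    · have h₂ := hγ (Fin.natAdd _ j)
      have h₃ : (γ (Fin.natAdd _ j)).1 = j.1 := by
        rw [h₂, Fin.val_natAdd]
        split_ifs <;> omega
      simp only [hN, Matrix.submatrix_apply, finSumFinEquiv_apply_right, id,
        Matrix.fromBlocks_apply₂₂]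
      refine MCM_apply_of_val_eq _ _ _ _ _ ?_
      rw [dif_pos (by omega)]
      simp only [c, h₃]
      omega
  have hdet : (N.submatrix ρ γ).det =
      X (MCVar.row ⟨q, by omega⟩ ⟨μ - s - 1, hmq⟩) * MCmono (k + (q + 1)) s k := by
    rw [← Matrix.det_submatrix_equiv_self finSumFinEquiv, hblocks, Matrix.det_fromBlocks_zero₂₁,
      Matrix.det_one, one_mul,
      MCZ_antidiagonal_minor _ s q (by omega) hs (μ - s - 1) hmq r _ _ c (fun _ => rfl),
      prod_Iic_eq_MCmono _ s k q rfl]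
    · simp only [r, hρ, Fin.val_natAdd, Fin.val_zero, add_zero]
      rw [if_neg (by omega), if_neg (by omega), if_pos trivial]
    · intro i hi
      have : i.1 ≠ 0 := fun h => hi (Fin.ext h)
      simp only [r, hρ, Fin.val_natAdd]
      split_ifs <;> omega
  have hperm : (N.submatrix ρ γ).det =
      (-1) ^ (k - (μ - s - 1) + (k + q) * (q + 1)) * N.det := by
    have : N.submatrix ρ γ = (N.submatrix id γ).submatrix ρ id := rfl
    rw [this, Matrix.det_permute, Matrix.det_permute', ← mul_assoc, pow_add,
      Fin.sign_cycleIcc_of_le (Fin.le_def.mpr hm.le), sign_finCycle]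
    simp
  have hsign : (-1 : MCRing (k + (q + 1)) s) ^ (k * (k + (q + 1) - k) + s + k + 1 - μ) =
      (-1) ^ (k - (μ - s - 1) + (k + q) * (q + 1)) := by
    obtain ⟨d, hd⟩ := Nat.even_mul_succ_self q
    have : k - (μ - s - 1) + (k + q) * (q + 1) =
        (k * (k + (q + 1) - k) + s + k + 1 - μ) + 2 * d := by
      rw [Nat.add_sub_cancel_left, add_mul, hd]
      omega
    rw [this, pow_add, pow_mul]
    simp
  have hX : ∀ (l : ℕ) (hl : l < k + (q + 1)) (h : μ - s - 1 < k + (q + 1) - (l + 1)), l = q →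
      (X (MCVar.row ⟨l, hl⟩ ⟨μ - s - 1, h⟩) : MCRing (k + (q + 1)) s) =
        X (MCVar.row ⟨q, by omega⟩ ⟨μ - s - 1, hmq⟩) := by
    rintro _ _ _ rfl
    rfl
  rw [hX _ _ _ (by omega), hsign, mul_assoc, ← hdet, hperm, ← mul_assoc, ← pow_add, ← two_mul,
    pow_mul]
  simp
end

section
/- For every p-element subset I ⊆ {1,…,n}, writing k = |I ∩ {s+1,…,n}|, the monomial ∏_{t=1}^{p−k} a_t^{p−k+1−t} divides P_I(M) in the polynomial ring R; i.e., there exists a (necessarily unique) polynomial Q_I ∈ R with P_I(M) = Q_I · ∏_{t=1}^{p−k} a_t^{p−k+1−t}. -/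
open MvPolynomial

/-- A product of `m` distinct partial products `∏ t ≤ k, x t` is divisible by the product of the
first `m` of them. -/
theorem prod_pow_dvd_prod_prod_Iic {R : Type*} [CommRing R] {p : ℕ} (x : Fin p → R)
    (T : Finset (Fin p)) :
    (∏ t : Fin p, if t.1 < T.card then x t ^ (T.card - t.1) else 1) ∣
      ∏ k ∈ T, ∏ t ∈ Finset.Iic k, x t := by
  have hswap : ∏ k ∈ T, ∏ t ∈ Finset.Iic k, x t =
      ∏ t : Fin p, x t ^ (T.filter fun k => t ≤ k).card := by
    rw [Finset.prod_comm' (s' := fun t => T.filter fun k => t ≤ k) (t' := Finset.univ)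
      (by intro k t; simp)]
    simp
  rw [hswap]
  refine Finset.prod_dvd_prod_of_dvd _ _ fun t _ => ?_
  split_ifs
  · apply pow_dvd_pow
    have h1 := Finset.card_filter_add_card_filter_not (s := T) (fun k => t ≤ k)
    have h2 : (T.filter fun k => ¬ t ≤ k).card ≤ t.1 := by
      calc _ ≤ (Finset.Iio t).card :=
            Finset.card_le_card fun k hk => by simpa using (Finset.mem_filter.1 hk).2
        _ = t.1 := by simp
    omega
  · exact one_dvd _

/-- If the columns of `A` indexed by `S` are combinations of the vectors `v k` with coefficients
`e k * w k c`, then any `d` dividing all products of `S.card` distinct `e k` divides `det A`. -/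
theorem dvd_det_of_columns_eq_sum {R n κ : Type*} [CommRing R] [Fintype n] [DecidableEq n]
    [Fintype κ] [DecidableEq κ] [Nonempty κ] (A : Matrix n n R) (S : Finset n) (e : κ → R)
    (v : κ → n → R) (w : κ → n → R) (hA : ∀ c ∈ S, ∀ i, A i c = ∑ k, e k * v k i * w k c)
    (d : R) (hd : ∀ T : Finset κ, T.card = S.card → d ∣ ∏ k ∈ T, e k) :
    d ∣ A.det := by
  classical
  obtain ⟨k₀⟩ := ‹Nonempty κ›
  let f := (Matrix.detRowAlternating (n := n) (R := R))
  let u : n → κ → n → R := fun c k => if c ∈ S then v k else A.transpose c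
  let α : n → κ → R := fun c k => if c ∈ S then e k * w k c else 1
  let B : n → Finset κ := fun c => if c ∈ S then Finset.univ else {k₀}
  have hcol : A.transpose = fun c => ∑ k ∈ B c, α c k • u c k := by
    funext c i
    by_cases hc : c ∈ S
    · simp only [Matrix.transpose_apply, hA c hc, B, α, u, hc, if_true, Finset.sum_apply,
        Pi.smul_apply, smul_eq_mul]
      exact Finset.sum_congr rfl fun k _ => by ring
    · simp [B, α, u, hc]
  have hdet : A.det = ∑ r ∈ Fintype.piFinset B, f fun c => α c (r c) • u c (r c) := by
    rw [← Matrix.det_transpose, hcol]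
    exact f.toMultilinearMap.map_sum_finset (fun c k => α c k • u c k) B
  rw [hdet]
  refine Finset.dvd_sum fun r _ => ?_
  have hsmul : (f fun c => α c (r c) • u c (r c)) =
      (∏ c, α c (r c)) • f fun c => u c (r c) :=
    f.toMultilinearMap.map_smul_univ (fun c => α c (r c)) fun c => u c (r c)
  rw [hsmul, smul_eq_mul]
  by_cases hr : Set.InjOn r S
  · have hprod : ∏ c, α c (r c) = (∏ k ∈ S.image r, e k) * ∏ c ∈ S, w (r c) c := by
      rw [Finset.prod_image hr, ← Finset.prod_mul_distrib]
      simp only [α]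
      rw [Finset.prod_ite_mem, Finset.univ_inter]
    rw [hprod, mul_assoc]
    exact (hd _ (Finset.card_image_of_injOn hr)).mul_right _
  · simp only [Set.InjOn, not_forall] at hr
    obtain ⟨c, hc, c', hc', hcc, hne⟩ := hr
    have hzero : (f fun c => u c (r c)) = 0 := by
      refine f.map_eq_zero_of_eq _ (i := c) (j := c') ?_ hne
      simp only [Finset.mem_coe] at hc hc'
      simp [u, hc, hc', hcc]
    rw [hzero, mul_zero]
    exact dvd_zero d

/-- divisibility step of Lemma 3.2.  For every `p`-element subset
`I ⊆ {1,…,n}` (`n = s+p`), writing `k = |I ∩ {s+1,…,n}|`, the monomial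
`∏_{t=1}^{p−k} a_t^{p−k+1−t}` divides `P_I(M)` in `R`: there is a polynomial `Q_I ∈ R`
with `P_I(M) = Q_I · ∏_{t=1}^{p−k} a_t^{p−k+1−t}`.  (`P_I(M)` is the determinant of the
`p × p` submatrix of `M` on the columns of `I`, taken in increasing order.) -/
theorem mono_dvd_plucker
    (p s : ℕ) (hp : 1 ≤ p) (hs : p ≤ s)
    (I : Finset (Fin (s + p))) (hI : I.card = p) :
    ∃ Q : MCRing p s,
      (Matrix.submatrix (MCM p s) id (fun t : Fin p => (I.orderIsoOfFin hI t).1)).det =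
        Q * MCmono p s ((I.filter fun i => s ≤ i.1).card) := by
  have : Nonempty (Fin p) := ⟨⟨0, hp⟩⟩
  let S : Finset (Fin p) := Finset.univ.filter fun t => (I.orderIsoOfFin hI t).1.1 < s
  have hcompl : (Finset.univ.filter fun t => ¬ (I.orderIsoOfFin hI t).1.1 < s).card =
      (I.filter fun i => s ≤ i.1).card := by
    refine Finset.card_bij (fun t _ => (I.orderIsoOfFin hI t).1) ?_ ?_ ?_
    · intro t ht
      exact Finset.mem_filter.2 ⟨(I.orderIsoOfFin hI t).2, not_lt.1 (Finset.mem_filter.1 ht).2⟩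
    · intro t _ t' _ h
      exact (I.orderIsoOfFin hI).injective (Subtype.ext h)
    · intro i hi
      obtain ⟨hiI, his⟩ := Finset.mem_filter.1 hi
      obtain ⟨t, ht⟩ := (I.orderIsoOfFin hI).surjective ⟨i, hiI⟩
      refine ⟨t, Finset.mem_filter.2 ⟨Finset.mem_univ _, ?_⟩, by rw [ht]⟩
      rw [ht]
      exact not_lt.2 his
  have hS : S.card = p - (I.filter fun i => s ≤ i.1).card := by
    have h := Finset.card_filter_add_card_filter_not (s := Finset.univ)
      (fun t => (I.orderIsoOfFin hI t).1.1 < s)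
    rw [hcompl, Finset.card_univ, Fintype.card_fin] at h
    exact Nat.eq_sub_of_add_eq h
  suffices h : MCmono p s (I.filter fun i => s ≤ i.1).card ∣
      (Matrix.submatrix (MCM p s) id (fun t : Fin p => (I.orderIsoOfFin hI t).1)).det by
    obtain ⟨Q, hQ⟩ := h
    exact ⟨Q, by rw [hQ, mul_comm]⟩
  refine dvd_det_of_columns_eq_sum _ S
    (fun k => ∏ t ∈ Finset.Iic k, X (MCVar.a t)) (MCv p s)
    (fun k t => if h : (I.orderIsoOfFin hI t).1.1 < s then MCw p s k ⟨_, h⟩ else 0) ?_ _ ?_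
  · intro t ht i
    have hlt : (I.orderIsoOfFin hI t).1.1 < s := (Finset.mem_filter.1 ht).2
    simp only [Matrix.submatrix_apply, id, MCM, MCZ, Matrix.of_apply, dif_pos hlt]
  · intro T hT
    rw [MCmono, ← hS, ← hT]
    exact prod_pow_dvd_prod_prod_Iic (fun t => X (MCVar.a t)) T
end

section
/- For each p-element subset I ⊆ {1,…,n}, writing k = |I ∩ {s+1,…,n}|, let Q_I ∈ R be the unique polynomial with P_I(M) = Q_I · ∏_{t=1}^{p−k} a_t^{p−k+1−t}. Then the ℤ-subalgebra of R generated by all entries of the matrix Z together with all the polynomials Q_I equals R itself; equivalently, every variable a_k (1 ≤ k ≤ p) and every variable ξ^{(k)}_{i,j} is an integer-coefficient polynomial in the entries of Z and the Q_I. -/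
open MvPolynomial

/-- A matrix that is triangular for an injective labelling of its indices has the product of its
diagonal entries as determinant. -/
theorem Matrix.BlockTriangular.det_of_injective {ι α R : Type*} [Fintype ι] [DecidableEq ι]
    [LinearOrder α] [CommRing R] {N : Matrix ι ι R} {β : ι → α} (hβ : Function.Injective β)
    (h : N.BlockTriangular β) : N.det = ∏ i, N i i := by
  let _ : LinearOrder ι := LinearOrder.lift' β hβ
  have h' : N.BlockTriangular id := fun i j hij => h hij
  convert Matrix.det_of_isUpperTriangular h'

/-- Permuting rows and columns changes a determinant at most by a sign. -/
theorem Matrix.det_submatrix_perm_eq_or_neg {ι R : Type*} [Fintype ι] [DecidableEq ι]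
    [CommRing R] (N : Matrix ι ι R) (σ τ : Equiv.Perm ι) :
    (N.submatrix σ τ).det = N.det ∨ (N.submatrix σ τ).det = -N.det := by
  have h : N.submatrix σ τ = (N.submatrix id τ).submatrix σ id := rfl
  rw [h, Matrix.det_permute, Matrix.det_permute']
  rcases Int.units_eq_one_or (Equiv.Perm.sign σ) with h1 | h1 <;>
  rcases Int.units_eq_one_or (Equiv.Perm.sign τ) with h2 | h2 <;> simp [h1, h2]

namespace MilleCrepes

variable {p s : ℕ}

theorem v_rev_of_lt {k a : Fin p} (h : a < k) : MCv p s k a.rev = 0 := by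
  have := Fin.lt_def.1 h
  have := k.2
  unfold MCv
  rw [dif_neg (by simp only [Fin.val_rev]; omega), if_neg (by simp only [Fin.val_rev]; omega)]

theorem v_rev_self (k : Fin p) : MCv p s k k.rev = 1 := by
  have := k.2
  unfold MCv
  rw [dif_neg (by simp only [Fin.val_rev]; omega), if_pos (by simp only [Fin.val_rev]; omega)]

theorem w_rev_of_lt {k : Fin p} {b : Fin s} (h : b.1 < k.1) : MCw p s k b.rev = 0 := by
  have := b.2
  unfold MCw
  rw [dif_neg (by simp only [Fin.val_rev]; omega), if_neg (by simp only [Fin.val_rev]; omega)]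

theorem w_rev_of_eq {k : Fin p} {b : Fin s} (h : b.1 = k.1) : MCw p s k b.rev = 1 := by
  have := b.2
  unfold MCw
  rw [dif_neg (by simp only [Fin.val_rev]; omega), if_pos (by simp only [Fin.val_rev]; omega)]

/-- The coefficient `a₀ ⋯ a_k` of the `k`-th summand of `Z`. -/
noncomputable def coeffA (p s : ℕ) (k : Fin p) : MCRing p s :=
  ∏ t ∈ Finset.Iic k, X (MCVar.a t)

theorem coeffA_ne_zero (k : Fin p) : coeffA p s k ≠ 0 :=
  Finset.prod_ne_zero_iff.2 fun _ _ => X_ne_zero _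

theorem coeffA_succ {k l : Fin p} (h : l.1 = k.1 + 1) :
    coeffA p s l = coeffA p s k * X (MCVar.a l) := by
  have : Finset.Iic l = insert l (Finset.Iic k) := by
    ext t
    simp only [Finset.mem_Iic, Finset.mem_insert, Fin.le_def, Fin.ext_iff]
    omega
  unfold coeffA
  rw [this, Finset.prod_insert (by simp only [Finset.mem_Iic, Fin.le_def]; omega), mul_comm]

theorem prod_coeffA (m : Fin p) :
    ∏ k ∈ Finset.Iic m, coeffA p s k = MCmono p s (p - (m.1 + 1)) := by
  unfold coeffA MCmono
  rw [Finset.prod_comm' (t' := Finset.univ) (s' := fun t => Finset.Icc t m) (by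
    intro x y
    simp [and_comm])]
  refine Finset.prod_congr rfl fun t _ => ?_
  have := m.2
  rw [Finset.prod_const, Fin.card_Icc]
  have h : p - (p - (m.1 + 1)) = m.1 + 1 := by omega
  rw [h]
  split_ifs with ht
  · rfl
  · rw [Nat.sub_eq_zero_of_le (by omega), pow_zero]

/-- The `(i, j)` entry, in reversed indices, of the part of `Z` made of the summands from the
`m`-th on. -/
noncomputable def tail (m i : Fin p) (j : Fin s) : MCRing p s :=
  ∑ k ∈ Finset.Ici m, coeffA p s k * MCv p s k i.rev * MCw p s k j.rev

theorem Z_rev (m i : Fin p) (j : Fin s) :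
    MCZ p s i.rev j.rev =
      ∑ k ∈ Finset.Iio m, coeffA p s k * MCv p s k i.rev * MCw p s k j.rev + tail m i j := by
  have h : Finset.Ici m = (Finset.Iio m)ᶜ := by ext; simp
  rw [tail, h, Finset.sum_add_sum_compl]
  rfl

theorem tail_of_row_lt {m i : Fin p} (j : Fin s) (h : i < m) : tail m i j = 0 :=
  Finset.sum_eq_zero fun k hk => by
    rw [v_rev_of_lt (h.trans_le (Finset.mem_Ici.1 hk))]; ring

theorem tail_of_col_lt {m : Fin p} (i : Fin p) {j : Fin s} (h : j.1 < m.1) :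
    tail m i j = 0 :=
  Finset.sum_eq_zero fun k hk => by
    rw [w_rev_of_lt (h.trans_le (Fin.le_def.1 (Finset.mem_Ici.1 hk)))]; ring

theorem tail_of_row_eq (m : Fin p) (j : Fin s) :
    tail m m j = coeffA p s m * MCw p s m j.rev := by
  rw [tail, Finset.sum_eq_single_of_mem m (by simp), v_rev_self, mul_one]
  intro k hk hkm
  rw [v_rev_of_lt (lt_of_le_of_ne (Finset.mem_Ici.1 hk) hkm.symm)]; ring

theorem tail_of_col_eq (m i : Fin p) {j : Fin s} (h : j.1 = m.1) :
    tail m i j = coeffA p s m * MCv p s m i.rev := by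
  rw [tail, Finset.sum_eq_single_of_mem m (by simp), w_rev_of_eq h, mul_one]
  intro k hk hkm
  have := lt_of_le_of_ne (Finset.mem_Ici.1 hk) hkm.symm
  rw [w_rev_of_lt (h.trans_lt this)]; ring

theorem tail_of_succ {m l : Fin p} {j : Fin s} (hl : l.1 = m.1 + 1) (hj : j.1 = l.1) :
    tail m l j = coeffA p s m *
      (MCv p s m l.rev * MCw p s m j.rev + X (MCVar.a l)) := by
  have h : Finset.Ici m = insert m (Finset.Ici l) := by
    ext t
    simp only [Finset.mem_Ici, Finset.mem_insert, Fin.le_def, Fin.ext_iff]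
    omega
  have h' := tail_of_row_eq l j
  rw [w_rev_of_eq hj] at h'
  rw [tail] at h' ⊢
  rw [h, Finset.sum_insert (by simp only [Finset.mem_Ici, Fin.le_def]; omega), h',
    coeffA_succ hl]
  ring

/-- The columns of `M` cutting out, up to sign, the minor of `Z` on the last `m` rows and columns
together with row `i` and column `j` (in reversed indices). -/
def cols (hs : p ≤ s) (m i : Fin p) (j : Fin s) (b : Fin p) : Fin (s + p) :=
  if b < m then Fin.castAdd p (Fin.castLE hs b).rev
  else if b = i then Fin.castAdd p j.rev
  else Fin.natAdd s b.rev

theorem M_castAdd (i : Fin p) (j : Fin s) : MCM p s i (Fin.castAdd p j) = MCZ p s i j := by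
  simp [MCM]

theorem M_natAdd (i j : Fin p) : MCM p s i (Fin.natAdd s j) = if i = j then 1 else 0 := by
  simp [MCM, Fin.ext_iff, eq_comm]

theorem cols_injective (hs : p ≤ s) {m i : Fin p} {j : Fin s} (hj : m.1 ≤ j.1) :
    Function.Injective (cols hs m i j) := by
  intro b c h
  have := j.2
  have := b.2
  have := c.2
  unfold cols at h
  split_ifs at h <;>
    simp only [Fin.ext_iff, Fin.lt_def, Fin.val_castAdd, Fin.val_natAdd, Fin.val_rev,
      Fin.val_castLE] at * <;> omega

theorem card_filter_cols (hs : p ≤ s) {m i : Fin p} {j : Fin s} (hi : m ≤ i) (hj : m.1 ≤ j.1) :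
    ((Finset.univ.image (cols hs m i j)).filter fun c => s ≤ c.1).card = p - (m.1 + 1) := by
  rw [Finset.filter_image, Finset.card_image_of_injective _ (cols_injective hs hj)]
  have h : (Finset.univ.filter fun b => s ≤ (cols hs m i j b).1) =
      (insert i (Finset.Iio m))ᶜ := by
    ext b
    have := j.2
    have := b.2
    simp only [Finset.mem_filter, Finset.mem_univ, true_and, Finset.mem_compl, Finset.mem_insert,
      Finset.mem_Iio, not_or]
    unfold cols
    split_ifs <;> simp only [Fin.val_castAdd, Fin.val_natAdd, Fin.val_rev, Fin.val_castLE] <;>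
      grind
  rw [h, Finset.card_compl, Finset.card_insert_of_notMem (by simpa using hi), Fin.card_Iio,
    Fintype.card_fin]

theorem det_cols (hs : p ≤ s) {m i : Fin p} (j : Fin s) (hi : m ≤ i) :
    ((MCM p s).submatrix Fin.rev (cols hs m i j)).det =
      (∏ k ∈ Finset.Iio m, coeffA p s k) * tail m i j := by
  let L : Matrix (Fin p) (Fin p) (MCRing p s) := Matrix.of fun a k =>
    if k < m then MCv p s k a.rev else if a = k then 1 else 0
  let T : Matrix (Fin p) (Fin p) (MCRing p s) := Matrix.of fun k b =>
    if b < m then (if k < m then coeffA p s k * MCw p s k (Fin.castLE hs b).rev else 0)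
    else if b = i then (if k < m then coeffA p s k * MCw p s k j.rev else tail m k j)
    else if k = b then 1 else 0
  have split_sum (a : Fin p) (f : Fin p → MCRing p s) :
      ∑ k, L a k * f k =
        ∑ k ∈ Finset.Iio m, MCv p s k a.rev * f k + if a < m then 0 else f a := by
    have h : (Finset.Iio m)ᶜ = Finset.Ici m := by ext; simp
    rw [← Finset.sum_add_sum_compl (Finset.Iio m), h]
    congr 1
    · refine Finset.sum_congr rfl fun k hk => ?_
      simp [L, Finset.mem_Iio.1 hk]
    · have : ∀ k ∈ Finset.Ici m, L a k * f k = if a = k then f k else 0 := by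
        intro k hk
        simp [L, not_lt.2 (Finset.mem_Ici.1 hk)]
      rw [Finset.sum_congr rfl this, Finset.sum_ite_eq]
      simp only [Finset.mem_Ici, ← not_lt, ite_not]
  have hLT : (MCM p s).submatrix Fin.rev (cols hs m i j) = L * T := by
    ext1 a b
    rw [Matrix.mul_apply, split_sum, Matrix.submatrix_apply]
    unfold cols
    by_cases hb : b < m
    · rw [if_pos hb, M_castAdd, Z_rev m, tail_of_col_lt _ (by simpa using hb)]
      congr 1
      · refine Finset.sum_congr rfl fun k hk => ?_
        simp only [T, Matrix.of_apply, if_pos hb, if_pos (Finset.mem_Iio.1 hk)]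
        ring
      · split_ifs with ha
        · rfl
        · simp [T, hb, ha]
    · rw [if_neg hb]
      by_cases hbi : b = i
      · rw [if_pos hbi, M_castAdd, Z_rev m]
        congr 1
        · refine Finset.sum_congr rfl fun k hk => ?_
          simp only [T, Matrix.of_apply, if_neg hb, if_pos hbi, if_pos (Finset.mem_Iio.1 hk)]
          ring
        · split_ifs with ha
          · exact tail_of_row_lt j ha
          · simp only [T, Matrix.of_apply, if_neg hb, if_pos hbi, if_neg ha]
      · rw [if_neg hbi, M_natAdd, Finset.sum_eq_zero, zero_add]
        · simp only [T, Matrix.of_apply, if_neg hb, if_neg hbi, Fin.rev_inj]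
          grind
        · intro k hk
          have hkb : k ≠ b := fun h => hb (h ▸ Finset.mem_Iio.1 hk)
          simp [T, hb, hbi, hkb]
  have hL : L.det = 1 := by
    rw [Matrix.det_of_isLowerTriangular]
    · refine Finset.prod_eq_one fun k _ => ?_
      simp [L, v_rev_self]
    · intro a k hak
      have hak : a < k := hak
      simp only [L, Matrix.of_apply, v_rev_of_lt hak, hak.ne, if_false, ite_self]
  have hT : T.det = (∏ k ∈ Finset.Iio m, coeffA p s k) * tail m i j := by
    have h : T.BlockTriangular fun k => if k = i then p else k.1 := by
      intro k b hkb
      have := k.2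
      have := b.2
      have hkb : (if b = i then p else b.1) < if k = i then p else k.1 := hkb
      simp only [T, Matrix.of_apply]
      split_ifs at hkb ⊢ with h1 h2 h3 h4 <;> try grind
      rw [w_rev_of_lt (by simpa using hkb), mul_zero]
    rw [h.det_of_injective]
    · rw [← Finset.prod_mul_prod_compl (Finset.Iio m)]
      congr 1
      · refine Finset.prod_congr rfl fun k hk => ?_
        simp [T, Finset.mem_Iio.1 hk, w_rev_of_eq]
      · rw [Finset.prod_eq_single_of_mem i (by simpa using hi)]
        · simp [T, not_lt.2 hi]
        · intro b hb hbi
          have hb : ¬ b < m := by simpa using hb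
          simp [T, hb, hbi]
    · intro k b hkb
      have := k.2
      have := b.2
      grind
  rw [hLT, Matrix.det_mul, hL, hT, one_mul]

/-- A Plücker coordinate on the columns `cols` yields the quotient of the corresponding entry of
`tail` by its coefficient. -/
theorem mem_of_tail_eq (hs : p ≤ s)
    {Q : (I : Finset (Fin (s + p))) → I.card = p → MCRing p s}
    (hQ : ∀ (I : Finset (Fin (s + p))) (hI : I.card = p),
      (Matrix.submatrix (MCM p s) id (fun t : Fin p => (I.orderIsoOfFin hI t).1)).det =
        Q I hI * MCmono p s ((I.filter fun i => s ≤ i.1).card))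
    {A : Subalgebra ℤ (MCRing p s)} (hA : ∀ I hI, Q I hI ∈ A)
    {m i : Fin p} {j : Fin s} (hi : m ≤ i) (hj : m.1 ≤ j.1) {x : MCRing p s}
    (hx : tail m i j = coeffA p s m * x) : x ∈ A := by
  have hg := cols_injective hs (i := i) hj
  let I := Finset.univ.image (cols hs m i j)
  have hI : I.card = p := by
    rw [Finset.card_image_of_injective _ hg, Finset.card_univ, Fintype.card_fin]
  have hex (t : Fin p) : ∃ b, cols hs m i j b = (I.orderIsoOfFin hI t).1 := by
    have h := (I.orderIsoOfFin hI t).2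
    obtain ⟨b, -, hb⟩ := Finset.mem_image.1 h
    exact ⟨b, hb⟩
  choose σ hσ using hex
  have hσi : Function.Injective σ := fun t u htu =>
    (I.orderIsoOfFin hI).injective (Subtype.ext (by rw [← hσ, ← hσ, htu]))
  let e : Equiv.Perm (Fin p) := Equiv.ofBijective σ (Finite.injective_iff_bijective.1 hσi)
  have hsub : (MCM p s).submatrix id (fun t : Fin p => (I.orderIsoOfFin hI t).1) =
      ((MCM p s).submatrix Fin.rev (cols hs m i j)).submatrix Fin.revPerm e := by
    ext1 a t
    simp [e, hσ]
  have hprod : (∏ k ∈ Finset.Iio m, coeffA p s k) * (coeffA p s m * x) =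
      x * MCmono p s (p - (m.1 + 1)) := by
    have : Finset.Iic m = insert m (Finset.Iio m) := by simp
    rw [← prod_coeffA, this, Finset.prod_insert (by simp)]
    ring
  have hmono : MCmono p s (p - (m.1 + 1)) ≠ 0 := by
    rw [← prod_coeffA]
    exact Finset.prod_ne_zero_iff.2 fun k _ => coeffA_ne_zero k
  have hdet := hQ I hI
  rw [card_filter_cols hs hi hj, hsub] at hdet
  have key := Matrix.det_submatrix_perm_eq_or_neg
    ((MCM p s).submatrix Fin.rev (cols hs m i j)) Fin.revPerm e
  rw [hdet, det_cols hs j hi, hx, hprod, ← neg_mul] at key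
  rcases key with h | h
  · rw [← mul_right_cancel₀ hmono h]
    exact hA I hI
  · rw [← neg_neg x, ← mul_right_cancel₀ hmono h]
    exact A.neg_mem (hA I hI)

end MilleCrepes

/-- coordinate-ring form of Lemma 3.2: `J^τ` is an embedding.
For each `p`-element subset `I ⊆ {1,…,n}` (`n = s+p`), with `k = |I ∩ {s+1,…,n}|`, let
`Q_I ∈ R` be the (necessarily unique) polynomial with
`P_I(M) = Q_I · ∏_{t=1}^{p−k} a_t^{p−k+1−t}`.  Then the `ℤ`-subalgebra of `R` generated by
the entries of `Z` together with all the `Q_I` is all of `R`. -/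
theorem adjoin_Z_and_Q_eq_top
    (p s : ℕ) (hp : 1 ≤ p) (hs : p ≤ s)
    (Q : (I : Finset (Fin (s + p))) → I.card = p → MCRing p s)
    (hQ : ∀ (I : Finset (Fin (s + p))) (hI : I.card = p),
      (Matrix.submatrix (MCM p s) id (fun t : Fin p => (I.orderIsoOfFin hI t).1)).det =
        Q I hI * MCmono p s ((I.filter fun i => s ≤ i.1).card)) :
    Algebra.adjoin ℤ
        ((Set.range fun ij : Fin p × Fin s => MCZ p s ij.1 ij.2) ∪
          {x | ∃ (I : Finset (Fin (s + p))) (hI : I.card = p), x = Q I hI}) = ⊤ := by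
  set A := Algebra.adjoin ℤ
        ((Set.range fun ij : Fin p × Fin s => MCZ p s ij.1 ij.2) ∪
          {x | ∃ (I : Finset (Fin (s + p))) (hI : I.card = p), x = Q I hI})
  have hA (I : Finset (Fin (s + p))) (hI : I.card = p) : Q I hI ∈ A :=
    Algebra.subset_adjoin (Or.inr ⟨I, hI, rfl⟩)
  have hZ (i : Fin p) (j : Fin s) : MCZ p s i j ∈ A :=
    Algebra.subset_adjoin (Or.inl ⟨(i, j), rfl⟩)
  have hv {k i : Fin p} (hi : k ≤ i) : MCv p s k i.rev ∈ A :=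
    MilleCrepes.mem_of_tail_eq hs hQ hA (j := Fin.castLE hs k) hi le_rfl
      (MilleCrepes.tail_of_col_eq k i rfl)
  have hw {k : Fin p} {j : Fin s} (hj : k.1 ≤ j.1) : MCw p s k j.rev ∈ A :=
    MilleCrepes.mem_of_tail_eq hs hQ hA le_rfl hj (MilleCrepes.tail_of_row_eq k j)
  rw [eq_top_iff, ← MvPolynomial.adjoin_range_X, Algebra.adjoin_le_iff]
  rintro _ ⟨x, rfl⟩
  cases x with
  | a l =>
    rcases Nat.eq_zero_or_pos l.1 with hl | hl
    · have h := MilleCrepes.Z_rev l l (Fin.castLE hs l)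
      have hIio : Finset.Iio l = ∅ := by
        ext t
        simp [Fin.le_def, hl]
      have hIic : Finset.Iic l = {l} := by
        ext t
        simp only [Finset.mem_Iic, Finset.mem_singleton, Fin.le_def, Fin.ext_iff]
        omega
      rw [hIio, Finset.sum_empty, zero_add, MilleCrepes.tail_of_row_eq,
        MilleCrepes.w_rev_of_eq (by simp), mul_one, MilleCrepes.coeffA, hIic,
        Finset.prod_singleton] at h
      exact h ▸ hZ _ _
    · let m : Fin p := ⟨l.1 - 1, by omega⟩
      have hlm : l.1 = m.1 + 1 := by simp only [m]; omega
      have hml : m ≤ l := by rw [Fin.le_def]; omega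
      have h := MilleCrepes.mem_of_tail_eq hs hQ hA (j := Fin.castLE hs l) hml hml
        (MilleCrepes.tail_of_succ hlm rfl)
      simpa using A.sub_mem h (A.mul_mem (hv hml) (hw (j := Fin.castLE hs l) hml))
  | row k t =>
    have ht := t.2
    let i : Fin p := ⟨t.1, by omega⟩
    have h := hv (k := k) (i := i.rev) (by simp only [Fin.le_def, Fin.val_rev, i]; omega)
    rw [Fin.rev_rev, MCv, dif_pos (by simp only [i]; omega)] at h
    exact h
  | col k t =>
    have ht := t.2
    let j : Fin s := ⟨t.1, by omega⟩
    have h := hw (k := k) (j := j.rev) (by simp only [Fin.val_rev, j]; omega)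
    rw [Fin.rev_rev, MCw, dif_pos (by simp only [j]; omega)] at h
    exact h
end

section
/- Every p×s matrix Z over K is the associated matrix of some Mille Crêpes datum: there exist a permutation (i₁,…,i_p) of (1,…,p), pairwise distinct indices j₁,…,j_p ∈ {1,…,s}, scalars a₁,…,a_p ∈ K, and vectors v^k ∈ K^p, w^k ∈ K^s (1 ≤ k ≤ p) with v^k_{i_k} = 1, v^k_{i_t} = 0 for 1 ≤ t < k, w^k_{j_k} = 1, w^k_{j_t} = 0 for 1 ≤ t < k, such that Z = Σ_{k=1}^p (∏_{t=1}^k a_t) · v^k (w^k)^T. -/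
/-- One step of elimination with complete pivoting: a matrix vanishing on the rows in `I` and the
columns in `J` splits off a rank-one pivot term, and the remainder, divided by the pivot, also
vanishes on the pivot row and the pivot column. -/
theorem Matrix.exists_pivot {K α β : Type*} [Field K] [DecidableEq α] [DecidableEq β]
    {I : Finset α} {J : Finset β} (hI : ∃ x, x ∉ I) (hJ : ∃ y, y ∉ J) (Z : Matrix α β K)
    (hZ : ∀ r c, r ∈ I ∨ c ∈ J → Z r c = 0) :
    ∃ x ∉ I, ∃ y ∉ J, ∃ (a : K) (v : α → K) (w : β → K) (Z' : Matrix α β K),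
      v x = 1 ∧ (∀ r ∈ I, v r = 0) ∧ w y = 1 ∧ (∀ c ∈ J, w c = 0) ∧
      (∀ r c, r ∈ insert x I ∨ c ∈ insert y J → Z' r c = 0) ∧
      Z = a • (Matrix.vecMulVec v w + Z') := by
  by_cases h : Z = 0
  · obtain ⟨x, hx⟩ := hI
    obtain ⟨y, hy⟩ := hJ
    refine ⟨x, hx, y, hy, 0, Pi.single x 1, Pi.single y 1, 0, by simp, fun r hr => ?_, by simp,
      fun c hc => ?_, by simp, by simp [h]⟩
    · exact Pi.single_eq_of_ne (ne_of_mem_of_not_mem hr hx) 1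
    · exact Pi.single_eq_of_ne (ne_of_mem_of_not_mem hc hy) 1
  · obtain ⟨x, y, hxy⟩ : ∃ x y, Z x y ≠ 0 := by
      by_contra! h'
      exact h (Matrix.ext h')
    refine ⟨x, fun hx => hxy (hZ x y (.inl hx)), y, fun hy => hxy (hZ x y (.inr hy)), Z x y,
      fun r => Z r y / Z x y, fun c => Z x c / Z x y,
      Matrix.of fun r c => Z r c / Z x y - Z r y / Z x y * (Z x c / Z x y),
      div_self hxy, fun r hr => by simp [hZ r y (.inl hr)], div_self hxy,
      fun c hc => by simp [hZ x c (.inr hc)], ?_, ?_⟩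
    · rintro r c (hr | hc)
      · rcases Finset.mem_insert.1 hr with rfl | hr
        · simp [div_self hxy]
        · simp [hZ r _ (.inl hr)]
      · rcases Finset.mem_insert.1 hc with rfl | hc
        · simp [div_self hxy]
        · simp [hZ _ c (.inr hc)]
    · ext r c
      simp [Matrix.vecMulVec_apply, mul_div_cancel₀ _ hxy]

theorem Fin.prod_Iic_succ {M : Type*} [CommMonoid M] {n : ℕ} (a : Fin (n + 1) → M) (k : Fin n) :
    ∏ t ∈ Finset.Iic k.succ, a t = a 0 * ∏ t ∈ Finset.Iic k, a t.succ := by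
  have h : ∀ {m : ℕ} (k : Fin m), Finset.Iic k = Finset.univ.filter (· ≤ k) := fun k => by
    ext; simp
  simp [h, Finset.prod_filter, Fin.prod_univ_succ]

/-- Iterated elimination with complete pivoting for a matrix vanishing outside `n` rows. -/
theorem Matrix.exists_iterated_pivot {K α β : Type*} [Field K] [Fintype α] [Fintype β]
    [DecidableEq α] [DecidableEq β] (n : ℕ) (I : Finset α) (J : Finset β)
    (hI : I.card + n = Fintype.card α) (hJ : J.card + n ≤ Fintype.card β) (Z : Matrix α β K)
    (hZ : ∀ r c, r ∈ I ∨ c ∈ J → Z r c = 0) :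
    ∃ (i : Fin n → α) (j : Fin n → β) (a : Fin n → K) (v : Fin n → α → K) (w : Fin n → β → K),
      (∀ k, ∀ r ∈ I, v k r = 0) ∧ (∀ k, ∀ c ∈ J, w k c = 0) ∧
      (∀ k, v k (i k) = 1) ∧ (∀ k t, t < k → v k (i t) = 0) ∧
      (∀ k, w k (j k) = 1) ∧ (∀ k t, t < k → w k (j t) = 0) ∧
      Z = ∑ k : Fin n, (∏ t ∈ Finset.Iic k, a t) • Matrix.vecMulVec (v k) (w k) := by
  induction n generalizing I J Z with
  | zero =>
    have hI' : I = Finset.univ := (Finset.card_eq_iff_eq_univ I).1 hI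
    have hZ' : Z = 0 := Matrix.ext fun r c => hZ r c (.inl (by simp [hI']))
    exact ⟨Fin.elim0, Fin.elim0, Fin.elim0, Fin.elim0, Fin.elim0, fun k => k.elim0,
      fun k => k.elim0, fun k => k.elim0, fun k => k.elim0, fun k => k.elim0, fun k => k.elim0,
      by simp [hZ']⟩
  | succ n ih =>
    have hI' : ∃ x, x ∉ I := by
      by_contra! h
      have := (Finset.card_eq_iff_eq_univ I).2 (Finset.eq_univ_of_forall h)
      omega
    have hJ' : ∃ y, y ∉ J := by
      by_contra! h
      have := (Finset.card_eq_iff_eq_univ J).2 (Finset.eq_univ_of_forall h)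
      omega
    obtain ⟨x, hx, y, hy, a₀, v₀, w₀, Z', hvx, hvI, hwy, hwJ, hZ', rfl⟩ :=
      Matrix.exists_pivot hI' hJ' Z hZ
    obtain ⟨i, j, a, v, w, hv, hw, hvi, hvt, hwj, hwt, rfl⟩ :=
      ih (insert x I) (insert y J) (by rw [Finset.card_insert_of_notMem hx]; omega)
        (by rw [Finset.card_insert_of_notMem hy]; omega) Z' hZ'
    refine ⟨Fin.cons x i, Fin.cons y j, Fin.cons a₀ a, Fin.cons v₀ v, Fin.cons w₀ w,
      Fin.cases hvI fun k r hr => hv k r (Finset.mem_insert_of_mem hr),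
      Fin.cases hwJ fun k c hc => hw k c (Finset.mem_insert_of_mem hc),
      Fin.cases hvx hvi, ?_, Fin.cases hwy hwj, ?_, ?_⟩
    · refine Fin.cases (fun t ht => absurd ht (Fin.not_lt_zero t)) fun k => Fin.cases ?_ ?_
      · exact fun _ => hv k x (Finset.mem_insert_self x I)
      · exact fun t ht => hvt k t (Fin.succ_lt_succ_iff.1 ht)
    · refine Fin.cases (fun t ht => absurd ht (Fin.not_lt_zero t)) fun k => Fin.cases ?_ ?_
      · exact fun _ => hw k y (Finset.mem_insert_self y J)
      · exact fun t ht => hwt k t (Fin.succ_lt_succ_iff.1 ht)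
    · have h₀ : Finset.Iic (0 : Fin (n + 1)) = {0} := by
        ext t
        simp
      simp [Fin.sum_univ_succ, Fin.prod_Iic_succ, h₀, smul_add, Finset.smul_sum, mul_smul]

theorem injective_of_triangular {K ι α : Type*} [LinearOrder ι] [MulZeroOneClass K] [Nontrivial K]
    {i : ι → α} {v : ι → α → K} (h₁ : ∀ k, v k (i k) = 1) (h₀ : ∀ k t, t < k → v k (i t) = 0) :
    Function.Injective i := by
  have hne : ∀ k t, t < k → i t ≠ i k := fun k t htk h =>
    one_ne_zero ((h₁ k).symm.trans (h ▸ h₀ k t htk))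
  intro k t h
  by_contra hkt
  rcases lt_or_gt_of_ne hkt with hlt | hlt
  · exact hne t k hlt h
  · exact hne k t hlt h.symm

/-- K-point content of Lemma 3.3: iterated Gaussian elimination with
complete pivoting.  Let `K` be a field and `0 < p ≤ s`.  Every `p × s` matrix `Z` over
`K` is the associated matrix of some Mille Crêpes datum: there are a permutation
`i` of `{1,…,p}` (a bijection `Fin p → Fin p`), pairwise distinct indices
`j : Fin p → Fin s`, scalars `a : Fin p → K`, and vectors `v k ∈ K^p`, `w k ∈ K^s`
with `v k (i k) = 1`, `v k (i t) = 0` for `t < k`, `w k (j k) = 1`, `w k (j t) = 0`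
for `t < k`, such that `Z = Σ_k (∏_{t ≤ k} a t) • (v k) (w k)^T`. -/
theorem exists_mille_crepes_datum
    (K : Type*) [Field K] (p s : ℕ) (hp : 0 < p) (hps : p ≤ s)
    (Z : Matrix (Fin p) (Fin s) K) :
    ∃ (i : Fin p → Fin p) (j : Fin p → Fin s) (a : Fin p → K)
      (v : Fin p → Fin p → K) (w : Fin p → Fin s → K),
      Function.Bijective i ∧ Function.Injective j ∧
      (∀ k, v k (i k) = 1) ∧ (∀ k t, t < k → v k (i t) = 0) ∧
      (∀ k, w k (j k) = 1) ∧ (∀ k t, t < k → w k (j t) = 0) ∧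
      Z = ∑ k : Fin p, (∏ t ∈ Finset.Iic k, a t) • Matrix.vecMulVec (v k) (w k) := by
  obtain ⟨i, j, a, v, w, -, -, hvi, hvt, hwj, hwt, hZ⟩ :=
    Matrix.exists_iterated_pivot p ∅ ∅ (by simp) (by simpa using hps) Z (by simp)
  exact ⟨i, j, a, v, w, Finite.injective_iff_bijective.1 (injective_of_triangular hvi hvt),
    injective_of_triangular hwj hwt, hvi, hvt, hwj, hwt, hZ⟩
end

section
/- Suppose two Mille Crêpes data with the same pivot sequence ((i₁,…,i_p),(j₁,…,j_p)) — with scalars a₁,…,a_p and a′₁,…,a′_p and vectors v^k, w^k and v′^k, w′^k respectively — have the same associated matrix Z, and suppose that a_k ≠ 0 for every 1 ≤ k ≤ p. Then the two data coincide: a_k = a′_k, v^k = v′^k, and w^k = w′^k for all 1 ≤ k ≤ p. -/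
/-- If two finite families have the same sum, agree below `k` and vanish above `k`,
then they agree at `k`. -/
theorem eq_at_of_sum_eq_of_eq_below_of_zero_above {ι M : Type*} [Fintype ι] [LinearOrder ι]
    [AddCommGroup M] {f g : ι → M} (k : ι) (hsum : ∑ t, f t = ∑ t, g t)
    (hlt : ∀ t < k, f t = g t) (hf : ∀ t, k < t → f t = 0) (hg : ∀ t, k < t → g t = 0) :
    f k = g k := by
  have hsingle : ∑ t, (f t - g t) = f k - g k := by
    refine Finset.sum_eq_single k (fun t _ ht => ?_) (by simp)
    rcases lt_or_gt_of_ne ht with h | h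
    · rw [hlt t h, sub_self]
    · rw [hf t h, hg t h, sub_self]
  rw [Finset.sum_sub_distrib, hsum, sub_self] at hsingle
  exact sub_eq_zero.mp hsingle.symm

/-- A sum of scaled rank-one matrices in echelon form with respect to fixed pivot positions
determines the scalars and the vectors, provided the scalars of one expression are nonzero. -/
theorem rank_one_echelon_sum_unique {K ι m n : Type*} [Field K] [Fintype ι] [LinearOrder ι]
    {i : ι → m} {j : ι → n} {c c' : ι → K} {v v' : ι → m → K} {w w' : ι → n → K}
    (hv1 : ∀ k, v k (i k) = 1) (hv0 : ∀ k t, t < k → v k (i t) = 0)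
    (hw1 : ∀ k, w k (j k) = 1) (hw0 : ∀ k t, t < k → w k (j t) = 0)
    (hv1' : ∀ k, v' k (i k) = 1) (hv0' : ∀ k t, t < k → v' k (i t) = 0)
    (hw1' : ∀ k, w' k (j k) = 1) (hw0' : ∀ k t, t < k → w' k (j t) = 0)
    (hc : ∀ k, c k ≠ 0)
    (hZ : ∑ k, c k • Matrix.vecMulVec (v k) (w k) =
          ∑ k, c' k • Matrix.vecMulVec (v' k) (w' k)) (k : ι) :
    c k = c' k ∧ v k = v' k ∧ w k = w' k := by
  induction k using WellFoundedLT.induction with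
  | ind k ih =>
    have hentry (x : m) (y : n) :
        ∑ t, c t * (v t x * w t y) = ∑ t, c' t * (v' t x * w' t y) := by
      simpa [Matrix.sum_apply, Matrix.vecMulVec_apply] using congrFun (congrFun hZ x) y
    have hbelow (x : m) (y : n) :
        ∀ t < k, c t * (v t x * w t y) = c' t * (v' t x * w' t y) := fun t ht => by
      obtain ⟨h₁, h₂, h₃⟩ := ih t ht
      rw [h₁, h₂, h₃]
    have hrow (y : n) : c k * w k y = c' k * w' k y := by
      simpa [hv1, hv1'] using eq_at_of_sum_eq_of_eq_below_of_zero_above k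
        (hentry (i k) y) (hbelow (i k) y)
        (fun t ht => by simp [hv0 t k ht]) (fun t ht => by simp [hv0' t k ht])
    have hcol (x : m) : c k * v k x = c' k * v' k x := by
      simpa [hw1, hw1'] using eq_at_of_sum_eq_of_eq_below_of_zero_above k
        (hentry x (j k)) (hbelow x (j k))
        (fun t ht => by simp [hw0 t k ht]) (fun t ht => by simp [hw0' t k ht])
    have hck : c k = c' k := by simpa [hw1, hw1'] using hrow (j k)
    refine ⟨hck, funext fun x => ?_, funext fun y => ?_⟩
    · exact mul_left_cancel₀ (hc k) ((hcol x).trans (by rw [hck]))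
    · exact mul_left_cancel₀ (hc k) ((hrow y).trans (by rw [hck]))

/-- A family of nonzero scalars is determined by its partial products. -/
theorem eq_of_prod_Iic_eq {K ι : Type*} [Field K] [Fintype ι] [LinearOrder ι]
    [LocallyFiniteOrderBot ι] {a a' : ι → K} (ha : ∀ k, a k ≠ 0)
    (h : ∀ k, ∏ t ∈ Finset.Iic k, a t = ∏ t ∈ Finset.Iic k, a' t) : a = a' := by
  funext k
  induction k using WellFoundedLT.induction with
  | ind k ih =>
    have hk := h k
    rw [← Finset.Iio_insert, Finset.prod_insert (by simp), Finset.prod_insert (by simp),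
      ← Finset.prod_congr rfl fun t ht => ih t (Finset.mem_Iio.mp ht)] at hk
    exact mul_right_cancel₀ (Finset.prod_ne_zero_iff.mpr fun t _ => ha t) hk

/-- injectivity of the Mille Crêpes parametrization on the locus of
nonzero pivots.  Two Mille Crêpes data with the same pivot sequence `(i, j)` and the same
associated matrix, all of whose pivot scalars `a k` are nonzero, coincide. -/
theorem mille_crepes_datum_unique
    (K : Type*) [Field K] (p s : ℕ) (hp : 0 < p) (hps : p ≤ s)
    (i : Fin p → Fin p) (j : Fin p → Fin s)
    (hi : Function.Bijective i) (hj : Function.Injective j)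
    (a a' : Fin p → K) (v v' : Fin p → Fin p → K) (w w' : Fin p → Fin s → K)
    (hv1 : ∀ k, v k (i k) = 1) (hv0 : ∀ k t, t < k → v k (i t) = 0)
    (hw1 : ∀ k, w k (j k) = 1) (hw0 : ∀ k t, t < k → w k (j t) = 0)
    (hv1' : ∀ k, v' k (i k) = 1) (hv0' : ∀ k t, t < k → v' k (i t) = 0)
    (hw1' : ∀ k, w' k (j k) = 1) (hw0' : ∀ k t, t < k → w' k (j t) = 0)
    (ha : ∀ k, a k ≠ 0)
    (hZ : ∑ k : Fin p, (∏ t ∈ Finset.Iic k, a t) • Matrix.vecMulVec (v k) (w k) =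
          ∑ k : Fin p, (∏ t ∈ Finset.Iic k, a' t) • Matrix.vecMulVec (v' k) (w' k)) :
    a = a' ∧ v = v' ∧ w = w' := by
  have key := rank_one_echelon_sum_unique hv1 hv0 hw1 hw0 hv1' hv0' hw1' hw0'
    (fun k => Finset.prod_ne_zero_iff.mpr fun t _ => ha t) hZ
  exact ⟨eq_of_prod_Iic_eq ha fun k => (key k).1, funext fun k => (key k).2.1,
    funext fun k => (key k).2.2⟩
end

section
/- Let a₁,…,a_p and v^k, w^k (1 ≤ k ≤ p) be a Mille Crêpes datum with associated matrix Z, and let 0 ≤ m ≤ p be such that a₁,…,a_m are all nonzero and either m = p or a_{m+1} = 0. Then the matrix Z has rank exactly m. -/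
open Matrix

/-- A sum of scaled outer products is a product of matrices with a diagonal middle factor. -/
theorem sum_smul_vecMulVec_eq {R ι m n : Type*} [CommSemiring R] [Fintype ι] [DecidableEq ι]
    (d : ι → R) (v : ι → m → R) (w : ι → n → R) :
    ∑ k, d k • vecMulVec (v k) (w k) = (of v)ᵀ * diagonal d * of w := by
  ext x y
  simp only [Matrix.sum_apply, Matrix.smul_apply, vecMulVec_apply, mul_apply (N := of w),
    mul_diagonal, transpose_apply, of_apply, smul_eq_mul]
  exact Finset.sum_congr rfl fun k _ => by ring

/-- If some rows of `V` and some columns of `W` form nonsingular matrices, then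
multiplying by `V` and `W` does not change the rank. -/
theorem rank_mul_mul_eq_of_submatrix_det_ne_zero {K ι m n : Type*} [Field K] [Fintype ι]
    [DecidableEq ι] [Fintype m] [Fintype n] (V : Matrix m ι K) (D : Matrix ι ι K)
    (W : Matrix ι n K) (r : ι → m) (c : ι → n) (hV : (V.submatrix r id).det ≠ 0)
    (hW : (W.submatrix id c).det ≠ 0) : (V * D * W).rank = D.rank := by
  apply le_antisymm
  · exact (rank_mul_le_left _ _).trans (rank_mul_le_right _ _)
  · have h : (V * D * W).submatrix r c = V.submatrix r id * D * W.submatrix id c := by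
      ext x y
      simp [mul_apply]
    calc D.rank = ((V * D * W).submatrix r c).rank := by
          rw [h, rank_mul_eq_left_of_det_ne_zero _ _ hW, rank_mul_eq_right_of_det_ne_zero _ _ hV]
      _ ≤ (V * D * W).rank := rank_submatrix_le _ _ _


/-- rank stratification in Mille Crêpes coordinates.  Let
`a, v, w` (with pivot sequence `(i, j)`) be a Mille Crêpes datum over a field `K` with
associated matrix `Z = Σ_k (∏_{t ≤ k} a t) • (v k)(w k)^T`, and let `0 ≤ m ≤ p` be such
that `a₁, …, a_m` are all nonzero and either `m = p` or `a_{m+1} = 0`.  Then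
`rank Z = m`. -/
theorem mille_crepes_rank
    (K : Type*) [Field K] (p s : ℕ) (hp : 0 < p) (hps : p ≤ s)
    (i : Fin p → Fin p) (j : Fin p → Fin s)
    (hi : Function.Bijective i) (hj : Function.Injective j)
    (a : Fin p → K) (v : Fin p → Fin p → K) (w : Fin p → Fin s → K)
    (hv1 : ∀ k, v k (i k) = 1) (hv0 : ∀ k t, t < k → v k (i t) = 0)
    (hw1 : ∀ k, w k (j k) = 1) (hw0 : ∀ k t, t < k → w k (j t) = 0)
    (m : ℕ) (hm : m ≤ p)
    (ha1 : ∀ k : Fin p, k.1 < m → a k ≠ 0)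
    (ha2 : m = p ∨ ∃ h : m < p, a ⟨m, h⟩ = 0) :
    (∑ k : Fin p, (∏ t ∈ Finset.Iic k, a t) • Matrix.vecMulVec (v k) (w k)).rank = m := by
  have hd (k : Fin p) : ∏ t ∈ Finset.Iic k, a t ≠ 0 ↔ k.1 < m := by
    rw [Finset.prod_ne_zero_iff]
    constructor
    · intro h
      by_contra! hk
      obtain rfl | ⟨hmp, h0⟩ := ha2
      · omega
      · exact h ⟨m, hmp⟩ (Finset.mem_Iic.2 hk) h0
    · intro hk t ht
      exact ha1 t (lt_of_le_of_lt (Fin.le_def.1 (Finset.mem_Iic.1 ht)) hk)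
  have hV : ((of v)ᵀ.submatrix i id).det ≠ 0 := by
    have h : ((of v)ᵀ.submatrix i id).IsLowerTriangular := fun t k h => hv0 k t h
    rw [det_of_isLowerTriangular _ h]
    simp [hv1]
  have hW : ((of w).submatrix id j).det ≠ 0 := by
    have h : ((of w).submatrix id j).IsUpperTriangular := fun k t h => hw0 k t h
    rw [det_of_isUpperTriangular h]
    simp [hw1]
  classical
  rw [sum_smul_vecMulVec_eq, rank_mul_mul_eq_of_submatrix_det_ne_zero _ _ _ i j hV hW,
    rank_diagonal, Fintype.card_congr (Equiv.subtypeEquivRight hd), Fintype.card_subtype,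
    Fin.card_filter_val_lt, min_eq_right hm]
end

section
/- For every integer 0 ≤ k ≤ r and every p-element subset I ⊆ {1,…,n} with |I ∩ {s+1,…,n}| = k, there exists a polynomial Q_I ∈ R₀ (in particular not involving b₁) such that P_I(M) = b₁^k · Q_I. Consequently, for each fixed k, the vector of type-k Plücker coordinates (P_I(M))_I equals b₁^k times a vector whose entries do not involve b₁. -/
open Polynomial in
/-- Columns in a set `T` being divisible by `X`, with constant quotient, and the others being
constant, a maximal minor is a constant times `X` to the number of its columns in `T`. -/
theorem exists_det_submatrix_eq_C_mul_X_pow {R : Type*} [CommRing R] {p n : ℕ}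
    (M : Matrix (Fin p) (Fin n) R[X]) (T : Fin n → Prop) [DecidablePred T]
    (hM : ∀ i j, ∃ c : R, M i j = (if T j then X else 1) * C c)
    (I : Finset (Fin n)) (hI : I.card = p) :
    ∃ Q : R, (M.submatrix id fun t : Fin p => (I.orderIsoOfFin hI t).1).det =
      C Q * X ^ (I.filter T).card := by
  choose N hN using hM
  let e : Fin p → Fin n := fun t => (I.orderIsoOfFin hI t).1
  have hfactor : M.submatrix id e =
      Matrix.of fun i j => (if T (e j) then X else 1) * C (N i (e j)) := by
    ext1 i j
    exact hN i (e j)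
  have hprod : ∏ t, (if T (e t) then (X : R[X]) else 1) = X ^ (I.filter T).card := by
    refine ((I.orderIsoOfFin hI).toEquiv.prod_comp
      fun j : I => if T j.1 then (X : R[X]) else 1).trans ?_
    rw [Finset.prod_coe_sort I fun j => if T j then (X : R[X]) else 1, ← Finset.prod_filter,
      Finset.prod_const]
  refine ⟨(Matrix.of fun i j => N i (e j)).det, ?_⟩
  rw [hfactor, Matrix.det_mul_row (fun j => if T (e j) then (X : R[X]) else 1)
    fun i j => C (N i (e j)), hprod, RingHom.map_det, mul_comm]
  rfl

open Polynomial in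
/-- An initial product of a sequence starting with `X` and continuing with constants is `X` times
a constant. -/
theorem exists_prod_Iic_eq_X_mul_C {R : Type*} [CommRing R] {r : ℕ} (b : Fin r → R[X])
    (hX : ∀ k : Fin r, k.1 = 0 → b k = X) (hC : ∀ k : Fin r, 0 < k.1 → ∃ c : R, b k = C c)
    (k : Fin r) : ∃ c : R, ∏ t ∈ Finset.Iic k, b t = X * C c := by
  have hr : 0 < r := k.pos
  have hmem : (⟨0, hr⟩ : Fin r) ∈ Finset.Iic k := Finset.mem_Iic.2 (Nat.zero_le k.1)
  choose! c hc using hC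
  refine ⟨∏ t ∈ (Finset.Iic k).erase ⟨0, hr⟩, c t, ?_⟩
  rw [← Finset.mul_prod_erase _ _ hmem, hX _ rfl, map_prod]
  congr 1
  refine Finset.prod_congr rfl fun t ht => hc t (Nat.pos_of_ne_zero fun h => ?_)
  exact (Finset.mem_erase.1 ht).1 (Fin.ext h)

/-- computational core of Lemmas 4.4 and 4.5.  Let `0 < p`,
`2p ≤ n ≤ 2s`, `s < n`, `r = min(p, n−s)`.  Fix pairwise distinct row pivots
`iIdx : Fin r → Fin p` and column pivots `jIdx : Fin r → Fin (n−s)` (indices in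
`{s+1,…,n}`).  Let `R₀` be the coefficient ring (the polynomial ring in the variables
`y_{ij}`, `b₂,…,b_r` and the free entries of the pivot vectors `Ξ_k`, `Ω_k`), realized
here as data: `Y` a `p × (s−p)` matrix over `R₀`, elements `b k ∈ R₀[b₁] = Polynomial R₀`
with `b 0 = b₁ = X` and `b k` a constant (an element of `R₀`) for `k ≥ 1`, and vectors
`Ξ k ∈ R₀^p`, `Ω k ∈ R₀^{n−s}` with `Ξ k (iIdx k) = 1`, `Ξ k (iIdx t) = 0` for `t < k`,
and similarly for `Ω`.  Let `M` be the `p × n` matrix over `R₀[b₁]` whose columns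
`1,…,s−p` form `Y`, columns `s−p+1,…,s` the identity, and columns `s+1,…,n` the matrix
`W = Σ_{k} (∏_{t ≤ k} b t) · (Ξ k)(Ω k)^T`.  Then for every `0 ≤ k ≤ r` and every
`p`-element subset `I ⊆ {1,…,n}` with `|I ∩ {s+1,…,n}| = k`, there is `Q_I ∈ R₀`
(in particular, not involving `b₁`) with `P_I(M) = b₁^k · Q_I`. -/
theorem plucker_b1_factorization
    (p s n : ℕ) (hp : 0 < p) (h2p : 2 * p ≤ n) (h2s : n ≤ 2 * s) (hsn : s < n)
    (r : ℕ) (hr : r = min p (n - s))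
    (iIdx : Fin r → Fin p) (hi : Function.Injective iIdx)
    (jIdx : Fin r → Fin (n - s)) (hj : Function.Injective jIdx)
    (R₀ : Type*) [CommRing R₀]
    (Y : Matrix (Fin p) (Fin (s - p)) R₀)
    (b : Fin r → Polynomial R₀)
    (hb1 : ∀ k : Fin r, k.1 = 0 → b k = Polynomial.X)
    (hb2 : ∀ k : Fin r, 0 < k.1 → ∃ c : R₀, b k = Polynomial.C c)
    (Ξ : Fin r → Fin p → R₀) (Ω : Fin r → Fin (n - s) → R₀)
    (hΞ1 : ∀ k, Ξ k (iIdx k) = 1) (hΞ0 : ∀ k t, t < k → Ξ k (iIdx t) = 0)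
    (hΩ1 : ∀ k, Ω k (jIdx k) = 1) (hΩ0 : ∀ k t, t < k → Ω k (jIdx t) = 0)
    (M : Matrix (Fin p) (Fin n) (Polynomial R₀))
    (hM : ∀ i (j : Fin n), M i j =
      if h1 : j.1 < s - p then Polynomial.C (Y i ⟨j.1, h1⟩)
      else if j.1 < s then (if s - p + i.1 = j.1 then 1 else 0)
      else ∑ k : Fin r, (∏ t ∈ Finset.Iic k, b t) * Polynomial.C (Ξ k i) *
        Polynomial.C (Ω k ⟨j.1 - s, by have := j.2; omega⟩))
    (I : Finset (Fin n)) (hI : I.card = p)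
    (k : ℕ) (hkr : k ≤ r) (hk : (I.filter fun i => s ≤ i.1).card = k) :
    ∃ Q : R₀,
      (Matrix.submatrix M id fun t : Fin p => (I.orderIsoOfFin hI t).1).det =
        Polynomial.C Q * Polynomial.X ^ k := by
  subst hk
  refine exists_det_submatrix_eq_C_mul_X_pow M (fun j => s ≤ j.1) (fun i j => ?_) I hI
  rw [hM]
  by_cases hjs : s ≤ j.1
  · choose c hc using exists_prod_Iic_eq_X_mul_C b hb1 hb2
    rw [dif_neg (by omega), if_neg (by omega), if_pos hjs]
    refine ⟨∑ l, c l * Ξ l i * Ω l ⟨j.1 - s, by have := j.2; omega⟩, ?_⟩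
    simp only [hc, map_sum, map_mul, Finset.mul_sum, mul_assoc]
  · rw [if_neg hjs]
    split_ifs
    · exact ⟨_, (one_mul _).symm⟩
    · exact ⟨1, by simp⟩
    · exact ⟨0, by simp⟩
    · omega
end
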